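/- (Injectivity of the Klain embedding) Let V be an n-dimensional Euclidean vector space, 0 ≤ k ≤ n, and let μ be a continuous, translation invariant, even, complex-valued valuation on V homogeneous of degree k. If μ(K) = 0 for every k-dimensional linear subspace E of V and every nonempty compact convex K ⊆ E, then μ = 0. -/

import Mathlib

open MeasureTheory Metric Set
open scoped Pointwise ENNReal

noncomputable section

variable {V : Type*} [NormedAddCommGroup V] [NormedSpace ℝ V]

/-- `μ` is a (complex-valued) valuation: additivity on unions of convex bodies whose
union is again convex. -/
def IsValuationC (μ : ConvexBody V → ℂ) : Prop :=
  ∀ K L M N : ConvexBody V,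
    (M : Set V) = (K : Set V) ∪ (L : Set V) → (N : Set V) = (K : Set V) ∩ (L : Set V) →
      μ M + μ N = μ K + μ L

/-- `μ` is translation invariant. -/
def IsTranslationInvariantC (μ : ConvexBody V → ℂ) : Prop :=
  ∀ (x : V) (K L : ConvexBody V), (L : Set V) = x +ᵥ (K : Set V) → μ L = μ K

/-- `μ` is homogeneous of degree `k`. -/
def IsHomogeneousValC (k : ℕ) (μ : ConvexBody V → ℂ) : Prop :=
  ∀ (t : ℝ), 0 ≤ t → ∀ K L : ConvexBody V,
    (L : Set V) = t • (K : Set V) → μ L = (t : ℂ) ^ k * μ K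

/-- `μ` is an even valuation. -/
def IsEvenValC (μ : ConvexBody V → ℂ) : Prop :=
  ∀ K L : ConvexBody V, (L : Set V) = -(K : Set V) → μ L = μ K

/-- `μ` is an odd valuation. -/
def IsOddValC (μ : ConvexBody V → ℂ) : Prop :=
  ∀ K L : ConvexBody V, (L : Set V) = -(K : Set V) → μ L = -μ K


/-! ### Support functions -/
section SupportFunction

variable {F : Type*} [NormedAddCommGroup F] [InnerProductSpace ℝ F]

/-- the support function of a convex body -/
def sf (K : ConvexBody F) (u : F) : ℝ := sSup ((fun x => inner ℝ u x) '' (K : Set F))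

theorem sf_bdd (K : ConvexBody F) (u : F) :
    BddAbove ((fun x => inner ℝ u x) '' (K : Set F)) :=
  (K.isCompact.image (by fun_prop)).bddAbove

theorem le_sf (K : ConvexBody F) (u : F) {x : F} (hx : x ∈ K) : inner ℝ u x ≤ sf K u :=
  le_csSup (sf_bdd K u) ⟨x, hx, rfl⟩

theorem sf_le (K : ConvexBody F) (u : F) {c : ℝ} (h : ∀ x ∈ K, inner ℝ u x ≤ c) : sf K u ≤ c := by
  apply csSup_le (K.nonempty.image _)
  rintro _ ⟨x, hx, rfl⟩
  exact h x hx

theorem exists_sf (K : ConvexBody F) (u : F) : ∃ x ∈ K, inner ℝ u x = sf K u := by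
  obtain ⟨x, hx, h⟩ := (K.isCompact.image (f := fun x => inner ℝ u x) (by fun_prop)).sSup_mem
    (K.nonempty.image _)
  exact ⟨x, hx, h⟩

theorem sf_add (K L : ConvexBody F) (u : F) : sf (K + L) u = sf K u + sf L u := by
  apply le_antisymm
  · apply sf_le
    intro x hx
    have hx' : x ∈ (K : Set F) + L := hx
    obtain ⟨a, ha, b, hb, rfl⟩ := Set.mem_add.1 hx'
    rw [inner_add_right]
    exact add_le_add (le_sf K u ha) (le_sf L u hb)
  · obtain ⟨a, ha, h1⟩ := exists_sf K u
    obtain ⟨b, hb, h2⟩ := exists_sf L u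
    rw [← h1, ← h2, ← inner_add_right]
    exact le_sf _ _ (show a + b ∈ (K : Set F) + L from Set.add_mem_add ha hb)

theorem sf_smul (K : ConvexBody F) {c : ℝ} (hc : 0 ≤ c) (u : F) : sf (c • K) u = c * sf K u := by
  apply le_antisymm
  · apply sf_le
    intro x hx
    have hx' : x ∈ c • (K : Set F) := hx
    obtain ⟨a, ha, rfl⟩ := Set.mem_smul_set.1 hx'
    rw [inner_smul_right]
    exact mul_le_mul_of_nonneg_left (le_sf K u ha) hc
  · obtain ⟨a, ha, h1⟩ := exists_sf K u
    rw [← h1, ← inner_smul_right]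
    exact le_sf _ _ (show c • a ∈ c • (K : Set F) from Set.smul_mem_smul_set ha)

theorem sf_zero (u : F) : sf (0 : ConvexBody F) u = 0 := by
  obtain ⟨x, hx, h⟩ := exists_sf (0 : ConvexBody F) u
  have : x = 0 := hx
  rw [← h, this, inner_zero_right]

theorem sf_subadd (K : ConvexBody F) (u v : F) : sf K (u + v) ≤ sf K u + sf K v := by
  apply sf_le
  intro x hx
  rw [inner_add_left]
  exact add_le_add (le_sf K u hx) (le_sf K v hx)

theorem sf_homog (K : ConvexBody F) {c : ℝ} (hc : 0 ≤ c) (u : F) : sf K (c • u) = c * sf K u := by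
  apply le_antisymm
  · apply sf_le
    intro x hx
    rw [real_inner_smul_left]
    exact mul_le_mul_of_nonneg_left (le_sf K u hx) hc
  · obtain ⟨a, ha, h1⟩ := exists_sf K u
    rw [← h1, ← real_inner_smul_left]
    exact le_sf _ _ ha

theorem exists_sf_bound (K : ConvexBody F) : ∃ R : ℝ, 0 ≤ R ∧ ∀ u, |sf K u| ≤ R * ‖u‖ := by
  obtain ⟨R, hR, h⟩ := K.isBounded.exists_pos_norm_le
  refine ⟨R, hR.le, fun u => ?_⟩
  obtain ⟨x, hx, e⟩ := exists_sf K u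
  rw [← e]
  calc |inner ℝ u x| ≤ ‖u‖ * ‖x‖ := abs_real_inner_le_norm _ _
    _ ≤ ‖u‖ * R := by gcongr; exact h x hx
    _ = R * ‖u‖ := mul_comm _ _

theorem exists_sf_lip (K : ConvexBody F) :
    ∃ R : ℝ, 0 ≤ R ∧ (∀ u, |sf K u| ≤ R * ‖u‖) ∧ ∀ u v, |sf K u - sf K v| ≤ R * ‖u - v‖ := by
  obtain ⟨R, hR, h⟩ := exists_sf_bound K
  refine ⟨R, hR, h, fun u v => ?_⟩
  have h1 := sf_subadd K (u - v) v
  have h2 := sf_subadd K (v - u) u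
  rw [sub_add_cancel] at h1 h2
  have h3 := h (u - v)
  have h4 := h (v - u)
  rw [norm_sub_rev v u] at h4
  rw [abs_le] at h3 h4 ⊢
  constructor <;> linarith

theorem sf_continuous (K : ConvexBody F) : Continuous (sf K) := by
  obtain ⟨R, hR, -, h⟩ := exists_sf_lip K
  apply LipschitzWith.continuous (K := ⟨R, hR⟩)
  apply LipschitzWith.of_dist_le_mul
  intro u v
  rw [Real.dist_eq, dist_eq_norm]
  exact h u v

/-- one-sided distance estimate -/
theorem exists_near_of_sf [FiniteDimensional ℝ F] (K L : ConvexBody F) {ε : ℝ}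
    (hε : 0 ≤ ε) (h : ∀ u, sf K u ≤ sf L u + ε * ‖u‖) (x : F) (hx : x ∈ K) :
    ∃ y ∈ (L : Set F), dist x y ≤ ε := by
  obtain ⟨y, hy, hmin⟩ := exists_norm_eq_iInf_of_complete_convex L.nonempty
    L.isClosed.isComplete L.convex x
  rw [norm_eq_iInf_iff_real_inner_le_zero L.convex hy] at hmin
  refine ⟨y, hy, ?_⟩
  rw [dist_eq_norm]
  have h1 : sf L (x - y) ≤ inner ℝ (x - y) y := by
    apply sf_le
    intro w hw
    have := hmin w hw
    rw [inner_sub_right] at this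
    linarith
  have h2 := le_sf K (x - y) hx
  have h3 := h (x - y)
  have h4 : ‖x - y‖ * ‖x - y‖ ≤ ε * ‖x - y‖ := by
    rw [← real_inner_self_eq_norm_mul_norm]
    rw [inner_sub_right (x - y) x y]
    linarith
  by_contra hc
  push Not at hc
  by_cases h5 : ‖x - y‖ = 0
  · rw [h5] at hc; linarith
  · have : 0 < ‖x - y‖ := lt_of_le_of_ne (norm_nonneg _) (Ne.symm h5)
    exact absurd (le_of_mul_le_mul_right h4 this) (not_le.2 hc)

theorem dist_le_of_sf [FiniteDimensional ℝ F] (K L : ConvexBody F) {ε : ℝ}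
    (hε : 0 ≤ ε) (h : ∀ u, |sf K u - sf L u| ≤ ε * ‖u‖) : dist K L ≤ ε := by
  rw [← ConvexBody.hausdorffDist_coe]
  apply hausdorffDist_le_of_mem_dist hε
  · intro x hx
    exact exists_near_of_sf K L hε (fun u => by have := abs_le.1 (h u); linarith) x hx
  · intro x hx
    exact exists_near_of_sf L K hε (fun u => by have := abs_le.1 (h u); linarith) x hx

theorem eq_of_sf [FiniteDimensional ℝ F] (K L : ConvexBody F)
    (h : ∀ u, sf K u = sf L u) : K = L := by
  apply eq_of_dist_eq_zero
  apply le_antisymm _ dist_nonneg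
  apply dist_le_of_sf _ _ le_rfl
  intro u
  simp [h u]

theorem mem_iff_sf [FiniteDimensional ℝ F] (K : ConvexBody F) (x : F) :
    x ∈ K ↔ ∀ u, inner ℝ u x ≤ sf K u := by
  refine ⟨fun h u => le_sf K u h, fun h => ?_⟩
  let P : ConvexBody F := ⟨{x}, convex_singleton x, isCompact_singleton, singleton_nonempty x⟩
  obtain ⟨y, hy, hd⟩ := exists_near_of_sf P K (ε := 0) le_rfl (fun u => by
    rw [zero_mul, add_zero]
    apply sf_le
    intro z hz
    have : z = x := hz
    rw [this]; exact h u) x (show x ∈ ({x} : Set F) from rfl)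
  have : x = y := dist_le_zero.1 hd
  rw [this]; exact hy

theorem exists_body [FiniteDimensional ℝ F] (h : F → ℝ) (hadd : ∀ u v, h (u + v) ≤ h u + h v)
    (hhom : ∀ c : ℝ, 0 < c → ∀ u, h (c • u) = c * h u) (hb : ∃ C : ℝ, ∀ u, h u ≤ C * ‖u‖) :
    ∃ K : ConvexBody F, ∀ u, sf K u = h u := by
  obtain ⟨C, hC⟩ := hb
  have h0 : h 0 = 0 := by
    have := hhom 2 (by norm_num) 0
    rw [smul_zero] at this
    linarith
  have key : ∀ u, ∃ x : F, (∀ v, inner ℝ v x ≤ h v) ∧ inner ℝ u x = h u := by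
    intro u
    by_cases hu : u = 0
    · obtain ⟨g, -, hg⟩ := exists_extension_of_le_sublinear (⊥ : F →ₗ.[ℝ] ℝ) h hhom hadd
        (by
          intro x
          have hx : (x : F) = 0 := (Submodule.mem_bot ℝ).1 x.2
          have : x = 0 := Subtype.ext hx
          rw [this]
          simp [h0])
      refine ⟨(InnerProductSpace.toDual ℝ F).symm (LinearMap.toContinuousLinearMap g), ?_, ?_⟩
      · intro v
        rw [real_inner_comm, InnerProductSpace.toDual_symm_apply]
        exact hg v
      · rw [hu, inner_zero_left, h0]
    · obtain ⟨g, hg1, hg⟩ := exists_extension_of_le_sublinear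
        (LinearPMap.mkSpanSingleton (K := ℝ) (σ := RingHom.id ℝ) u (h u) hu) h hhom hadd
        (by
          rintro ⟨x, hx⟩
          obtain ⟨c, rfl⟩ := Submodule.mem_span_singleton.1 hx
          rw [LinearPMap.mkSpanSingleton'_apply]
          simp only [smul_eq_mul, RingHom.id_apply]
          rcases lt_trichotomy c 0 with hc | hc | hc
          · have e1 := hhom (-c) (by linarith) u
            have e2 := hadd (c • u) ((-c) • u)
            rw [← add_smul, add_neg_cancel, zero_smul, h0, e1] at e2
            linarith
          · simp [hc, h0]
          · rw [hhom c hc])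
      refine ⟨(InnerProductSpace.toDual ℝ F).symm (LinearMap.toContinuousLinearMap g), ?_, ?_⟩
      · intro v
        rw [real_inner_comm, InnerProductSpace.toDual_symm_apply]
        exact hg v
      · rw [real_inner_comm, InnerProductSpace.toDual_symm_apply]
        have hmem : u ∈ (LinearPMap.mkSpanSingleton (K := ℝ) (σ := RingHom.id ℝ) u (h u) hu).domain :=
          Submodule.mem_span_singleton.2 ⟨1, one_smul _ _⟩
        have := hg1 ⟨u, hmem⟩
        simp only at this
        change g u = h u
        rw [this]
        have e := LinearPMap.mkSpanSingleton_apply ℝ ℝ (σ := RingHom.id ℝ) hu (h u)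
        exact e
  let S : Set F := {x | ∀ v, inner ℝ v x ≤ h v}
  have hS : S = ⋂ v, {x | inner ℝ v x ≤ h v} := by ext; simp [S]
  have hcl : IsClosed S := by
    rw [hS]
    exact isClosed_iInter fun v => isClosed_le (by fun_prop) continuous_const
  have hbd : Bornology.IsBounded S := by
    rw [isBounded_iff_forall_norm_le]
    refine ⟨max C 0, fun x hx => ?_⟩
    have h1 := hx x
    have h2 := hC x
    rw [real_inner_self_eq_norm_mul_norm] at h1
    have h3 : ‖x‖ * ‖x‖ ≤ C * ‖x‖ := h1.trans h2
    by_cases hx0 : ‖x‖ = 0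
    · rw [hx0]; exact le_max_right _ _
    · exact (le_of_mul_le_mul_right h3
        (lt_of_le_of_ne (norm_nonneg _) (Ne.symm hx0))).trans (le_max_left _ _)
  have hcv : Convex ℝ S := by
    rw [hS]
    apply convex_iInter
    intro v
    exact convex_halfSpace_le (IsLinearMap.mk (fun x y => inner_add_right _ _ _)
      (fun c x => by rw [inner_smul_right]; rfl)) _
  obtain ⟨x0, hx0, -⟩ := key 0
  refine ⟨⟨S, hcv, isCompact_of_isClosed_isBounded hcl hbd, ⟨x0, hx0⟩⟩, fun u => ?_⟩
  apply le_antisymm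
  · apply sf_le
    intro x hx
    exact hx u
  · obtain ⟨x, hx, e⟩ := key u
    rw [← e]
    exact le_sf _ _ hx

/-- The segment `[a, b]` as a convex body. -/
def segBody (a b : F) : ConvexBody F :=
  ⟨segment ℝ a b, convex_segment a b, by
    rw [← convexHull_pair]
    exact (Set.toFinite {a, b}).isCompact_convexHull ℝ, ⟨a, left_mem_segment ℝ a b⟩⟩

theorem sf_segBody (a b u : F) : sf (segBody a b) u = max (inner ℝ u a) (inner ℝ u b) := by
  apply le_antisymm
  · apply sf_le
    rintro x ⟨s, t, hs, ht, hst, rfl⟩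
    rw [inner_add_right, inner_smul_right, inner_smul_right]
    have h1 := le_max_left (inner ℝ u a : ℝ) (inner ℝ u b)
    have h2 := le_max_right (inner ℝ u a : ℝ) (inner ℝ u b)
    calc s * inner ℝ u a + t * inner ℝ u b
        ≤ s * max (inner ℝ u a) (inner ℝ u b) + t * max (inner ℝ u a) (inner ℝ u b) := by gcongr
      _ = max (inner ℝ u a) (inner ℝ u b) := by rw [← add_mul, hst, one_mul]
  · exact max_le (le_sf _ _ (left_mem_segment ℝ a b)) (le_sf _ _ (right_mem_segment ℝ a b))

end SupportFunction

/-! ### Basic facts on valuations -/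
section ValuationBasics

variable {F : Type*} [NormedAddCommGroup F] [InnerProductSpace ℝ F]

/-- The standing hypotheses. -/
structure KV (k : ℕ) (μ : ConvexBody F → ℂ) : Prop where
  val : IsValuationC μ
  cont : Continuous μ
  trans : IsTranslationInvariantC μ
  even : IsEvenValC μ
  hom : IsHomogeneousValC k μ

theorem sf_dist (K L : ConvexBody F) (u : F) : |sf K u - sf L u| ≤ dist K L * ‖u‖ := by
  have key : ∀ K L : ConvexBody F, sf K u ≤ sf L u + dist K L * ‖u‖ := by
    intro K L
    apply sf_le
    intro x hx
    obtain ⟨y, hy, e⟩ := L.isCompact.exists_infDist_eq_dist L.nonempty x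
    have h1 : infDist x (L : Set F) ≤ hausdorffDist (K : Set F) L :=
      infDist_le_hausdorffDist_of_mem hx ConvexBody.hausdorffEDist_ne_top
    rw [e, ConvexBody.hausdorffDist_coe, dist_eq_norm] at h1
    have h2 : inner ℝ u x = inner ℝ u y + inner ℝ u (x - y) := by
      rw [← inner_add_right]; congr 1; abel
    rw [h2]
    apply add_le_add (le_sf L u hy)
    calc inner ℝ u (x - y) ≤ ‖u‖ * ‖x - y‖ := real_inner_le_norm _ _
      _ ≤ ‖u‖ * dist K L := by gcongr
      _ = _ := mul_comm _ _
  have h1 := key K L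
  have h2 := key L K
  rw [dist_comm L K] at h2
  rw [abs_le]
  constructor <;> linarith

theorem dist_add_le [FiniteDimensional ℝ F] (K L M N : ConvexBody F) :
    dist (K + M) (L + N) ≤ dist K L + dist M N := by
  apply dist_le_of_sf _ _ (by positivity)
  intro u
  have h1 := sf_dist K L u
  have h2 := sf_dist M N u
  rw [sf_add, sf_add, add_mul]
  rw [abs_le] at *
  constructor <;> linarith

theorem continuous_add_body [FiniteDimensional ℝ F] (S : ConvexBody F) :
    Continuous (fun K : ConvexBody F => K + S) := by
  apply LipschitzWith.continuous (K := 1)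
  apply LipschitzWith.of_dist_le_mul
  intro K L
  have := dist_add_le K L S S
  simpa using this

theorem dist_smul_body_le [FiniteDimensional ℝ F] (K : ConvexBody F) {R : ℝ} (hR0 : 0 ≤ R)
    (hR : ∀ u, |sf K u| ≤ R * ‖u‖)
    {s t : ℝ} (hs : 0 ≤ s) (ht : 0 ≤ t) : dist (s • K) (t • K) ≤ |s - t| * R := by
  apply dist_le_of_sf _ _ (by positivity)
  intro u
  rw [sf_smul K hs, sf_smul K ht, ← sub_mul, abs_mul, mul_assoc]
  exact mul_le_mul_of_nonneg_left (hR u) (abs_nonneg _)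

theorem exists_mem_segment_inter {K L : Set F} (hK : IsClosed K) (hL : IsClosed L)
    (hc : Convex ℝ (K ∪ L)) {a b : F} (ha : a ∈ K) (hb : b ∈ L) :
    ∃ s t : ℝ, 0 ≤ s ∧ 0 ≤ t ∧ s + t = 1 ∧ s • a + t • b ∈ K ∩ L := by
  have hsub : segment ℝ a b ⊆ K ∪ L := hc.segment_subset (Or.inl ha) (Or.inr hb)
  have hpre : IsPreconnected (segment ℝ a b) := (convex_segment a b).isPreconnected
  rw [isPreconnected_closed_iff] at hpre
  obtain ⟨x, hx, hxK, hxL⟩ := hpre K L hK hL hsub ⟨a, left_mem_segment ℝ a b, ha⟩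
    ⟨b, right_mem_segment ℝ a b, hb⟩
  obtain ⟨s, t, hs, ht, hst, rfl⟩ := hx
  exact ⟨s, t, hs, ht, hst, hxK, hxL⟩

theorem inter_add_of_convex_union {K L S : Set F} (hK : IsClosed K) (hL : IsClosed L)
    (hc : Convex ℝ (K ∪ L)) (hS : Convex ℝ S) : (K ∩ L) + S = (K + S) ∩ (L + S) := by
  apply Subset.antisymm
  · exact Set.subset_inter (Set.add_subset_add_right inter_subset_left)
      (Set.add_subset_add_right inter_subset_right)
  · rintro x ⟨⟨a, ha, p, hp, rfl⟩, ⟨b, hb, q, hq, e⟩⟩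
    simp only at e
    obtain ⟨s, t, hs, ht, hst, hm⟩ := exists_mem_segment_inter hK hL hc ha hb
    refine ⟨s • a + t • b, hm, s • p + t • q, hS hp hq hs ht hst, ?_⟩
    simp only
    have : s • (a + p) + t • (b + q) = a + p := by
      rw [e, ← add_smul, hst, one_smul]
    rw [← this]
    simp only [smul_add]
    abel

theorem seg_eq_image (u : F) {a b : ℝ} (hab : a ≤ b) :
    (segBody (a • u) (b • u) : Set F) = (fun t : ℝ => t • u) '' Icc a b := by
  rw [← segment_eq_Icc hab]
  have := image_segment ℝ (LinearMap.toSpanSingleton ℝ F u).toAffineMap a b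
  exact this.symm

theorem vadd_add_left (x : F) (A B : Set F) : (x +ᵥ A) + B = x +ᵥ (A + B) := by
  have h : ∀ C : Set F, x +ᵥ C = {x} + C := fun C => by rw [Set.singleton_add]; rfl
  rw [h, h, add_assoc]

theorem vadd_add_right (x : F) (A B : Set F) : A + (x +ᵥ B) = x +ᵥ (A + B) := by
  rw [add_comm, vadd_add_left, add_comm]

theorem KV.add_seg_aux {k : ℕ} {μ : ConvexBody F → ℂ} (h : KV k μ) (K : ConvexBody F) (u : F)
    {a b : ℝ} (ha : 0 ≤ a) (hb : 0 ≤ b) :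
    μ (K + segBody ((0 : ℝ) • u) ((a + b) • u)) + μ K
      = μ (K + segBody ((0 : ℝ) • u) (a • u)) + μ (K + segBody ((0 : ℝ) • u) (b • u)) := by
  have e1 : (segBody ((0 : ℝ) • u) ((a + b) • u) : Set F)
      = (segBody ((0 : ℝ) • u) (a • u) : Set F) ∪ segBody (a • u) ((a + b) • u) := by
    rw [seg_eq_image u (by linarith), seg_eq_image u ha, seg_eq_image u (by linarith),
      ← image_union, Icc_union_Icc_eq_Icc ha (by linarith)]
  have e2 : ({a • u} : Set F)
      = (segBody ((0 : ℝ) • u) (a • u) : Set F) ∩ segBody (a • u) ((a + b) • u) := by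
    rw [seg_eq_image u ha, seg_eq_image u (by linarith)]
    apply Subset.antisymm
    · rintro x rfl
      exact ⟨⟨a, ⟨ha, le_rfl⟩, rfl⟩, ⟨a, ⟨le_rfl, by linarith⟩, rfl⟩⟩
    · rintro x ⟨⟨p, ⟨hp1, hp2⟩, rfl⟩, ⟨q, ⟨hq1, hq2⟩, e⟩⟩
      simp only at e
      by_cases hu : u = 0
      · simp [hu]
      · have : q = p := smul_left_injective ℝ hu e
        have : p = a := by linarith
        rw [this]; rfl
  let P : ConvexBody F := ⟨{a • u}, convex_singleton _, isCompact_singleton, singleton_nonempty _⟩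
  have e3 : μ (K + P) = μ K := by
    apply h.trans (a • u)
    rw [ConvexBody.coe_add]
    change (K : Set F) + {a • u} = _
    rw [add_comm, Set.singleton_add]
    rfl
  have e4 : μ (K + segBody (a • u) ((a + b) • u)) = μ (K + segBody ((0 : ℝ) • u) (b • u)) := by
    apply h.trans (a • u)
    rw [ConvexBody.coe_add, ConvexBody.coe_add, seg_eq_image u (by linarith), seg_eq_image u hb]
    have : (fun t : ℝ => t • u) '' Icc a (a + b) = a • u +ᵥ ((fun t : ℝ => t • u) '' Icc 0 b) := by
      apply Subset.antisymm
      · rintro _ ⟨t, ⟨h1, h2⟩, rfl⟩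
        refine ⟨(t - a) • u, ⟨t - a, ⟨by linarith, by linarith⟩, rfl⟩, ?_⟩
        simp only [vadd_eq_add, ← add_smul]
        congr 1; ring
      · rintro _ ⟨_, ⟨t, ⟨h1, h2⟩, rfl⟩, rfl⟩
        refine ⟨a + t, ⟨by linarith, by linarith⟩, ?_⟩
        simp only [vadd_eq_add, ← add_smul]
    rw [this]
    rw [vadd_add_right]
  have := h.val (K + segBody ((0 : ℝ) • u) (a • u)) (K + segBody (a • u) ((a + b) • u))
    (K + segBody ((0 : ℝ) • u) ((a + b) • u)) (K + P)
    (by rw [ConvexBody.coe_add, e1, Set.add_union]; rfl)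
    (by
      simp only [ConvexBody.coe_add]
      change (K : Set F) + {a • u} = _
      rw [e2, add_comm, inter_add_of_convex_union (ConvexBody.isClosed _) (ConvexBody.isClosed _)
        _ K.convex, add_comm, add_comm (segBody (a • u) ((a + b) • u) : Set F)]
      rw [← e1]; exact ConvexBody.convex _)
  rw [e3, e4] at this
  exact this

theorem additive_linear {f : ℝ → ℂ} (hc : ContinuousOn f (Ici 0))
    (hadd : ∀ a b : ℝ, 0 ≤ a → 0 ≤ b → f (a + b) = f a + f b) {t : ℝ} (ht : 0 ≤ t) :
    f t = t * f 1 := by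
  have key : ∀ a b c d : ℝ, 0 ≤ a → 0 ≤ b → 0 ≤ c → 0 ≤ d → a - b = c - d →
      f a - f b = f c - f d := by
    intro a b c d ha hb hc hd e
    have h1 := hadd a d ha hd
    have h2 := hadd c b hc hb
    have : a + d = c + b := by linarith
    rw [this] at h1
    have h3 := h1.symm.trans h2
    linear_combination h3
  let g : ℝ →+ ℂ :=
    { toFun := fun t => f (max t 0) - f (max (-t) 0)
      map_zero' := by simp
      map_add' := by
        intro a b
        have e : ∀ x : ℝ, max x 0 - max (-x) 0 = x := by
          intro x
          rcases le_total 0 x with h | h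
          · rw [max_eq_left h, max_eq_right (by linarith)]; ring
          · rw [max_eq_right h, max_eq_left (by linarith)]; ring
        have h1 := key (max (a + b) 0) (max (-(a + b)) 0) (max a 0 + max b 0)
          (max (-a) 0 + max (-b) 0) (le_max_right _ _) (le_max_right _ _)
          (by positivity) (by positivity) (by
            rw [e]
            have := e a
            have := e b
            linarith)
        rw [hadd _ _ (le_max_right _ _) (le_max_right _ _),
          hadd _ _ (le_max_right _ _) (le_max_right _ _)] at h1
        rw [h1]; ring }
  have gc : Continuous g := by
    change Continuous fun t => f (max t 0) - f (max (-t) 0)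
    apply Continuous.sub
    · exact hc.comp_continuous (by fun_prop) (fun x => Set.mem_Ici.2 (le_max_right _ _))
    · exact hc.comp_continuous (by fun_prop) (fun x => Set.mem_Ici.2 (le_max_right _ _))
  have h0 : f 0 = 0 := by
    have := hadd 0 0 le_rfl le_rfl
    simpa using this
  have hg : ∀ t : ℝ, 0 ≤ t → g t = f t := by
    intro t ht
    change f (max t 0) - f (max (-t) 0) = f t
    rw [max_eq_left ht, max_eq_right (by linarith), h0, sub_zero]
  have := map_real_smul g gc t 1
  rw [smul_eq_mul, mul_one, hg t ht, hg 1 zero_le_one] at this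
  rw [this, Complex.real_smul]

theorem KV.add_seg {k : ℕ} [FiniteDimensional ℝ F] {μ : ConvexBody F → ℂ} (h : KV k μ)
    (K : ConvexBody F) (u : F) {t : ℝ} (ht : 0 ≤ t) :
    μ (K + segBody 0 (t • u)) - μ K = t * (μ (K + segBody 0 u) - μ K) := by
  have := additive_linear (f := fun t : ℝ => μ (K + segBody 0 (t • u)) - μ K) ?_ ?_ ht
  · simpa using this
  · apply Continuous.continuousOn
    apply Continuous.sub _ continuous_const
    apply h.cont.comp
    apply LipschitzWith.continuous (K := ⟨‖u‖, norm_nonneg _⟩)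
    apply LipschitzWith.of_dist_le_mul
    intro s t
    apply dist_le_of_sf
    · exact mul_nonneg (NNReal.coe_nonneg _) dist_nonneg
    intro v
    simp only [sf_add, sf_segBody, inner_zero_right, inner_smul_right]
    rw [add_sub_add_left_eq_sub]
    refine (abs_max_sub_max_le_max _ _ _ _).trans ?_
    rw [sub_self, abs_zero, max_eq_right (abs_nonneg _), ← sub_mul, abs_mul]
    have := abs_real_inner_le_norm v u
    change _ ≤ ‖u‖ * |s - t| * ‖v‖
    calc |s - t| * |inner ℝ v u| ≤ |s - t| * (‖v‖ * ‖u‖) := by gcongr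
      _ = _ := by ring
  · intro a b ha hb
    have := h.add_seg_aux K u ha hb
    simp only [zero_smul] at this
    beta_reduce
    linear_combination this

theorem KV.zero_body {k : ℕ} (hk : k ≠ 0) {μ : ConvexBody F → ℂ} (h : KV k μ) :
    μ 0 = 0 := by
  have := h.hom 0 le_rfl 0 0 (by rw [ConvexBody.coe_zero]; simp)
  simpa [hk] using this

/-- difference valuation in the direction of a segment -/
theorem KV.diff_seg {k : ℕ} [FiniteDimensional ℝ F] {μ : ConvexBody F → ℂ} (h : KV (k + 1) μ)
    (u : F) : KV k (fun K => μ (K + segBody 0 u) - μ K) where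
  val := by
    intro K L M N hM hN
    have h1 := h.val K L M N hM hN
    have h2 := h.val (K + segBody 0 u) (L + segBody 0 u) (M + segBody 0 u) (N + segBody 0 u)
      (by simp only [ConvexBody.coe_add, hM, Set.union_add])
      (by
        simp only [ConvexBody.coe_add, hN]
        apply inter_add_of_convex_union K.isClosed L.isClosed _ (ConvexBody.convex _)
        rw [← hM]; exact M.convex)
    linear_combination h2 - h1
  cont := (h.cont.comp (continuous_add_body _)).sub h.cont
  trans := by
    intro x K L e
    have h1 := h.trans x K L e
    have h2 := h.trans x (K + segBody 0 u) (L + segBody 0 u) (by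
      rw [ConvexBody.coe_add, ConvexBody.coe_add, e, vadd_add_left])
    simp only [h1, h2]
  even := by
    intro K L e
    have h1 := h.even K L e
    have h2 : μ (L + segBody 0 u) = μ (L + segBody 0 (-u)) := by
      apply h.trans u
      rw [ConvexBody.coe_add, ConvexBody.coe_add]
      have : (segBody 0 u : Set F) = u +ᵥ (segBody 0 (-u) : Set F) := by
        change segment ℝ 0 u = u +ᵥ segment ℝ 0 (-u)
        rw [segment_symm]
        ext x
        rw [Set.mem_vadd_set_iff_neg_vadd_mem]
        have := mem_segment_translate ℝ u (x := -u + x) (b := 0) (c := -u)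
        simp at this
        rw [vadd_eq_add, ← this]
      rw [this, vadd_add_right]
    have h3 : μ (L + segBody 0 (-u)) = μ (K + segBody 0 u) := by
      apply h.even
      rw [ConvexBody.coe_add, ConvexBody.coe_add, e, neg_add]
      congr 1
      change segment ℝ 0 (-u) = - segment ℝ 0 u
      have := image_segment ℝ (-LinearMap.id : F →ₗ[ℝ] F).toAffineMap 0 u
      simp at this
      rw [← this]
    simp only [h1, h2, h3]
  hom := by
    have pos : ∀ t : ℝ, 0 < t → ∀ K : ConvexBody F,
        μ (t • K + segBody 0 u) - μ (t • K) = (t : ℂ) ^ k * (μ (K + segBody 0 u) - μ K) := by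
      intro t ht K
      have h1 := h.hom t ht.le K (t • K) rfl
      have h2 := h.hom t ht.le (K + segBody 0 (t⁻¹ • u)) (t • K + segBody 0 u) (by
        rw [ConvexBody.coe_add, ConvexBody.coe_add, smul_add]
        congr 1
        change segment ℝ 0 u = t • segment ℝ 0 (t⁻¹ • u)
        have := image_segment ℝ (t • LinearMap.id : F →ₗ[ℝ] F).toAffineMap 0 (t⁻¹ • u)
        simp [smul_smul, ht.ne'] at this
        rw [← this])
      have h3 := h.add_seg K u (inv_nonneg.2 ht.le)
      have h4 : (t : ℂ) * ((t⁻¹ : ℝ) : ℂ) = 1 := by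
        rw [← Complex.ofReal_mul, mul_inv_cancel₀ ht.ne', Complex.ofReal_one]
      rw [h1, h2]
      linear_combination (t : ℂ) ^ (k + 1) * h3 + (t : ℂ) ^ k * (μ (K + segBody 0 u) - μ K) * h4
    intro t ht K L e
    have eL : L = t • K := ConvexBody.ext e
    subst eL
    rcases ht.eq_or_lt with h0 | h0
    · subst h0
      obtain ⟨R, hR0, hR⟩ := exists_sf_bound K
      have lim : Filter.Tendsto (fun n : ℕ => (1 / ((n : ℝ) + 1)) • K) Filter.atTop
          (nhds ((0 : ℝ) • K)) := by
        rw [tendsto_iff_dist_tendsto_zero]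
        have hlim : Filter.Tendsto (fun n : ℕ => (1 / ((n : ℝ) + 1)) * R) Filter.atTop (nhds 0) := by
          simpa using (tendsto_one_div_add_atTop_nhds_zero_nat (𝕜 := ℝ)).mul_const R
        refine squeeze_zero (fun _ => dist_nonneg) (fun n => ?_) hlim
        have := dist_smul_body_le K hR0 hR (s := 1 / ((n : ℝ) + 1)) (t := 0) (by positivity) le_rfl
        rwa [sub_zero, abs_of_nonneg (by positivity)] at this
      have c1 : Continuous (fun K => μ (K + segBody 0 u) - μ K) :=
        (h.cont.comp (continuous_add_body _)).sub h.cont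
      have l1 := (c1.tendsto _).comp lim
      have l2 : Filter.Tendsto (fun n : ℕ => (((1 / ((n : ℝ) + 1) : ℝ) : ℂ)) ^ k
          * (μ (K + segBody 0 u) - μ K)) Filter.atTop
          (nhds (((0 : ℝ) : ℂ) ^ k * (μ (K + segBody 0 u) - μ K))) := by
        apply Filter.Tendsto.mul_const
        apply Filter.Tendsto.pow
        exact (Complex.continuous_ofReal.tendsto _).comp
          (tendsto_one_div_add_atTop_nhds_zero_nat (𝕜 := ℝ))
      refine tendsto_nhds_unique l1 (l2.congr ?_)
      intro n
      exact (pos _ (by positivity) K).symm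
    · exact pos t h0 K

end ValuationBasics

/-! ### The cone of bodies that can be added for free -/
section ZonoidCone

variable {F : Type*} [NormedAddCommGroup F] [InnerProductSpace ℝ F]

theorem closed_cone_integral_mem {E Q : Type*} [NormedAddCommGroup E] [NormedSpace ℝ E]
    [CompleteSpace E] [MeasurableSpace Q] (ν : Measure Q) {C : Set E} (hc : IsClosed C)
    (hconv : Convex ℝ C) (h0 : (0 : E) ∈ C) (hsm : ∀ c : ℝ, 0 < c → ∀ x ∈ C, c • x ∈ C)
    {f : Q → E} (hf : Integrable f ν) (hfC : ∀ q, f q ∈ C) : ∫ q, f q ∂ν ∈ C := by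
  by_contra hn
  obtain ⟨l, u, hl, hu⟩ := geometric_hahn_banach_closed_point hconv hc hn
  have hu0 : 0 < u := by simpa using hl 0 h0
  have hneg : ∀ a ∈ C, l a ≤ 0 := by
    intro a ha
    by_contra! hpos
    have := hl ((u / l a) • a) (hsm _ (by positivity) a ha)
    rw [map_smul, smul_eq_mul, div_mul_cancel₀ _ hpos.ne'] at this
    exact lt_irrefl _ this
  have : l (∫ q, f q ∂ν) ≤ 0 := by
    rw [← l.integral_comp_comm hf]
    exact integral_nonpos (fun q => hneg _ (hfC q))
  linarith

theorem sf_diff_sphere (K L : ConvexBody F) {ε : ℝ}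
    (h : ∀ x : F, ‖x‖ = 1 → |sf K x - sf L x| ≤ ε) (u : F) : |sf K u - sf L u| ≤ ε * ‖u‖ := by
  by_cases hu : u = 0
  · have h1 : ∀ K : ConvexBody F, sf K 0 = 0 := fun K => by
      have := sf_homog K (c := 0) le_rfl 0
      simpa using this
    simp [hu, h1]
  · have hn : 0 < ‖u‖ := norm_pos_iff.2 hu
    have e : u = ‖u‖ • (‖u‖⁻¹ • u) := by rw [smul_smul, mul_inv_cancel₀ hn.ne', one_smul]
    have e1 : ‖‖u‖⁻¹ • u‖ = 1 := by
      rw [norm_smul, norm_inv, norm_norm, inv_mul_cancel₀ hn.ne']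
    have := h _ e1
    rw [e, sf_homog K hn.le, sf_homog L hn.le, ← mul_sub, abs_mul, ← e, abs_of_pos hn, mul_comm]
    gcongr

/-- restrictions to the sphere of support functions of bodies that do not affect `μ` -/
def zcone (μ : ConvexBody F → ℂ) : Set C(sphere (0 : F) 1, ℝ) :=
  {w | ∃ Z : ConvexBody F, (∀ x : sphere (0 : F) 1, sf Z x = w x) ∧ ∀ K, μ (K + Z) = μ K}

/-- absolute value of a linear functional on the sphere -/
def absC (u : F) : C(sphere (0 : F) 1, ℝ) := ⟨fun x => |inner ℝ u (x : F)|, by fun_prop⟩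

variable [FiniteDimensional ℝ F] {k : ℕ} {μ : ConvexBody F → ℂ}

theorem zcone_zero : (0 : C(sphere (0 : F) 1, ℝ)) ∈ zcone μ :=
  ⟨0, fun x => by rw [sf_zero]; rfl, fun K => by rw [add_zero]⟩

theorem zcone_smul (h : KV k μ) (c : ℝ) (hc : 0 < c) (w) (hw : w ∈ zcone μ) :
    c • w ∈ zcone μ := by
  obtain ⟨Z, hZ, hμ⟩ := hw
  refine ⟨c • Z, fun x => ?_, fun K => ?_⟩
  · rw [sf_smul _ hc.le, hZ]; rfl
  · have e : K + c • Z = c • (c⁻¹ • K + Z) := by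
      rw [smul_add, smul_smul, mul_inv_cancel₀ hc.ne', one_smul]
    rw [e, h.hom c hc.le _ _ (ConvexBody.coe_smul c _), hμ,
      h.hom c⁻¹ (inv_nonneg.2 hc.le) _ _ (ConvexBody.coe_smul _ _), ← mul_assoc, ← mul_pow,
      ← Complex.ofReal_mul, mul_inv_cancel₀ hc.ne']
    simp

theorem zcone_add (w₁ w₂) (h₁ : w₁ ∈ zcone μ) (h₂ : w₂ ∈ zcone μ) : w₁ + w₂ ∈ zcone μ := by
  obtain ⟨Z₁, e₁, m₁⟩ := h₁
  obtain ⟨Z₂, e₂, m₂⟩ := h₂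
  refine ⟨Z₁ + Z₂, fun x => ?_, fun K => ?_⟩
  · rw [sf_add, e₁, e₂]; rfl
  · rw [← add_assoc, m₂, m₁]

theorem zcone_convex (h : KV k μ) : Convex ℝ (zcone μ) := by
  intro x hx y hy a b ha hb _
  have key : ∀ c : ℝ, 0 ≤ c → ∀ x ∈ zcone μ, c • x ∈ zcone μ := by
    intro c hc x hx
    rcases hc.eq_or_lt with rfl | hc
    · rw [zero_smul]; exact zcone_zero
    · exact zcone_smul h c hc x hx
  exact zcone_add _ _ (key a ha x hx) (key b hb y hy)

theorem zcone_closed (h : KV k μ) : IsClosed (zcone μ) := by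
  apply IsSeqClosed.isClosed
  intro w W hw hlim
  choose Z hZ hμ using hw
  have hd : ∀ n m, ∀ u, |sf (Z n) u - sf (Z m) u| ≤ dist (w n) (w m) * ‖u‖ := by
    intro n m
    apply sf_diff_sphere
    intro x hx
    have h1 := hZ n ⟨x, by simpa using hx⟩
    have h2 := hZ m ⟨x, by simpa using hx⟩
    simp only at h1 h2
    rw [h1, h2, ← Real.dist_eq]
    exact ContinuousMap.dist_apply_le_dist _
  have hcs : ∀ u, CauchySeq (fun n => sf (Z n) u) := by
    intro u
    have hc := hlim.cauchySeq
    rw [Metric.cauchySeq_iff] at hc ⊢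
    intro ε hε
    obtain ⟨N, hN⟩ := hc (ε / (‖u‖ + 1)) (by positivity)
    refine ⟨N, fun m hm n hn => ?_⟩
    rw [Real.dist_eq]
    refine (hd m n u).trans_lt ?_
    have := hN m hm n hn
    calc dist (w m) (w n) * ‖u‖ ≤ dist (w m) (w n) * (‖u‖ + 1) := by gcongr; linarith
      _ < ε / (‖u‖ + 1) * (‖u‖ + 1) := by gcongr
      _ = ε := by field_simp
  choose H hH using fun u => cauchySeq_tendsto_of_complete (hcs u)
  have hb : ∀ n u, |sf (Z n) u - H u| ≤ dist (w n) W * ‖u‖ := by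
    intro n u
    have l1 : Filter.Tendsto (fun m => |sf (Z n) u - sf (Z m) u|) Filter.atTop
        (nhds |sf (Z n) u - H u|) := (tendsto_const_nhds.sub (hH u)).abs
    have l2 : Filter.Tendsto (fun m => dist (w n) (w m) * ‖u‖) Filter.atTop
        (nhds (dist (w n) W * ‖u‖)) := (tendsto_const_nhds.dist hlim).mul_const _
    exact le_of_tendsto_of_tendsto' l1 l2 (fun m => hd n m u)
  obtain ⟨K0, hK0⟩ := exists_body H
    (fun u v => le_of_tendsto_of_tendsto' (hH _) ((hH u).add (hH v)) (fun n => sf_subadd _ _ _))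
    (fun c hc u => tendsto_nhds_unique (hH _)
      (((hH u).const_mul c).congr (fun n => (sf_homog _ hc.le _).symm)))
    (by
      obtain ⟨R, hR0, hR⟩ := exists_sf_bound (Z 0)
      refine ⟨R + dist (w 0) W, fun u => ?_⟩
      have h1 := abs_le.1 (hb 0 u)
      have h2 := abs_le.1 (hR u)
      rw [add_mul]; linarith)
  have hZK : Filter.Tendsto Z Filter.atTop (nhds K0) := by
    rw [tendsto_iff_dist_tendsto_zero]
    refine squeeze_zero (fun _ => dist_nonneg) (fun n => ?_) (tendsto_iff_dist_tendsto_zero.1 hlim)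
    apply dist_le_of_sf _ _ dist_nonneg
    intro u
    rw [hK0]
    exact hb n u
  refine ⟨K0, fun x => ?_, fun K => ?_⟩
  · rw [hK0]
    refine tendsto_nhds_unique (hH x) ?_
    have := ((continuous_eval_const (F := C(sphere (0 : F) 1, ℝ)) x).tendsto W).comp hlim
    exact this.congr (fun n => (hZ n x).symm)
  · have := (h.cont.tendsto _).comp (((continuous_add_body K).tendsto K0).comp hZK)
    refine tendsto_nhds_unique (by rw [add_comm K K0]; exact this) ?_
    refine tendsto_const_nhds.congr (fun n => ?_)
    simp only [Function.comp]
    rw [add_comm, hμ]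

theorem absC_lip (u v : F) : dist (absC u) (absC v) ≤ dist u v := by
  rw [ContinuousMap.dist_le dist_nonneg]
  intro x
  rw [Real.dist_eq, dist_eq_norm]
  change |(|inner ℝ u (x : F)| - |inner ℝ v (x : F)|)| ≤ _
  refine (abs_abs_sub_abs_le_abs_sub _ _).trans ?_
  rw [← inner_sub_left]
  have h1 := abs_real_inner_le_norm (u - v) (x : F)
  have h2 : ‖(x : F)‖ = 1 := by simp
  rwa [h2, mul_one] at h1

theorem absC_continuous : Continuous (absC : F → C(sphere (0 : F) 1, ℝ)) := by
  apply LipschitzWith.continuous (K := 1)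
  apply LipschitzWith.of_dist_le_mul
  intro u v
  simpa using absC_lip u v

theorem absC_norm (u : F) : ‖absC u‖ ≤ ‖u‖ := by
  have := absC_lip u 0
  have e : absC (0 : F) = 0 := by ext x; simp [absC]
  rwa [e, dist_zero_right, dist_zero_right] at this

theorem exists_zonoid (h : KV k μ) (hseg : ∀ K u, μ (K + segBody (-u) u) = μ K)
    {Q : Type*} [MeasurableSpace Q] (ν : Measure Q) (ρ : Q → ℝ) (U : Q → F)
    (hρ0 : ∀ q, 0 ≤ ρ q) (hρ : AEStronglyMeasurable ρ ν) (hU : AEStronglyMeasurable U ν)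
    (hIntg : Integrable (fun q => ρ q * ‖U q‖) ν) :
    ∃ Z : ConvexBody F, (∀ x, ‖x‖ = 1 → sf Z x = ∫ q, ρ q * |inner ℝ (U q) x| ∂ν) ∧
      ∀ K, μ (K + Z) = μ K := by
  have hi : Integrable (fun q => ρ q • absC (U q)) ν := by
    refine hIntg.mono' (hρ.smul (absC_continuous.comp_aestronglyMeasurable hU)) ?_
    filter_upwards with q
    rw [norm_smul, Real.norm_of_nonneg (hρ0 q)]
    exact mul_le_mul_of_nonneg_left (absC_norm _) (hρ0 q)
  have hm : ∀ q, ρ q • absC (U q) ∈ zcone μ := by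
    intro q
    have h1 : absC (U q) ∈ zcone μ := by
      refine ⟨segBody (-(U q)) (U q), fun x => ?_, fun K => hseg K _⟩
      rw [sf_segBody, inner_neg_right, real_inner_comm, max_comm]
      rfl
    rcases (hρ0 q).eq_or_lt with e | e
    · rw [← e, zero_smul]; exact zcone_zero
    · exact zcone_smul h _ e _ h1
  obtain ⟨Z, hZ, hμ⟩ := closed_cone_integral_mem ν (zcone_closed h) (zcone_convex h) zcone_zero
    (zcone_smul h) hi hm
  refine ⟨Z, fun x hx => ?_, hμ⟩
  have := hZ ⟨x, by simpa using hx⟩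
  simp only at this
  rw [this]
  exact ContinuousMap.integral_apply hi ⟨x, by simpa using hx⟩

end ZonoidCone

/-! ### Gaussian integrals -/
section GaussianPart

variable {F : Type*} [NormedAddCommGroup F] [InnerProductSpace ℝ F] [FiniteDimensional ℝ F]
  [MeasurableSpace F] [BorelSpace F]

theorem gauss_integrable {b : ℝ} (hb : 0 < b) :
    Integrable (fun v : F => Real.exp (-b * ‖v‖ ^ 2)) := by
  have h := GaussianFourier.integrable_cexp_neg_mul_sq_norm_add (b := (b : ℂ)) (by simpa using hb)
    0 (0 : F)
  have h2 := h.re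
  refine h2.congr ?_
  filter_upwards with v
  have : (-(b : ℂ) * (‖v‖ : ℂ) ^ 2 + 0 * ((inner ℝ (0 : F) v : ℝ) : ℂ))
      = ((-b * ‖v‖ ^ 2 : ℝ) : ℂ) := by push_cast; ring
  rw [this, ← Complex.ofReal_exp]
  simp only [RCLike.re_to_complex, Complex.ofReal_re]

theorem one_add_sq_mul_exp_le {b : ℝ} (hb : 0 < b) (r : ℝ) :
    (1 + r ^ 2) * Real.exp (-b * r ^ 2) ≤ (1 + 2 / b) * Real.exp (-(b / 2) * r ^ 2) := by
  have h1 : b / 2 * r ^ 2 ≤ Real.exp (b / 2 * r ^ 2) := by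
    have := Real.add_one_le_exp (b / 2 * r ^ 2); linarith
  have h2 : 1 ≤ Real.exp (b / 2 * r ^ 2) := Real.one_le_exp (by positivity)
  have h3 : 1 + r ^ 2 ≤ (1 + 2 / b) * Real.exp (b / 2 * r ^ 2) := by
    have : r ^ 2 = 2 / b * (b / 2 * r ^ 2) := by field_simp
    have h4 : 2 / b * (b / 2 * r ^ 2) ≤ 2 / b * Real.exp (b / 2 * r ^ 2) := by gcongr
    rw [add_mul]; linarith
  calc (1 + r ^ 2) * Real.exp (-b * r ^ 2)
      ≤ ((1 + 2 / b) * Real.exp (b / 2 * r ^ 2)) * Real.exp (-b * r ^ 2) := by gcongr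
    _ = _ := by rw [mul_assoc, ← Real.exp_add]; congr 2; ring

theorem gauss_integrable_sq {b : ℝ} (hb : 0 < b) :
    Integrable (fun v : F => (1 + ‖v‖ ^ 2) * Real.exp (-b * ‖v‖ ^ 2)) := by
  refine ((gauss_integrable (F := F) (half_pos hb)).const_mul (1 + 2 / b)).mono'
    (by fun_prop) ?_
  filter_upwards with v
  rw [Real.norm_of_nonneg (by positivity)]
  exact one_add_sq_mul_exp_le hb _

theorem gauss_pos {b : ℝ} (hb : 0 < b) : 0 < ∫ v : F, Real.exp (-b * ‖v‖ ^ 2) := by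
  rw [GaussianFourier.integral_rexp_neg_mul_sq_norm hb]
  positivity

theorem gauss_cos {b : ℝ} (hb : 0 < b) (q : F) :
    ∫ v : F, Real.exp (-b * ‖v‖ ^ 2) * Real.cos (inner ℝ v q)
      = (∫ v : F, Real.exp (-b * ‖v‖ ^ 2)) * Real.exp (-(‖q‖ ^ 2) / (4 * b)) := by
  have hb' : 0 < (b : ℂ).re := by simpa using hb
  have h1 := GaussianFourier.integral_cexp_neg_mul_sq_norm_add hb' Complex.I q
  have h2 := GaussianFourier.integral_cexp_neg_mul_sq_norm (V := F) hb'
  have h3 : ∫ v : F, Complex.exp (-(b : ℂ) * (‖v‖ : ℂ) ^ 2)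
      = ((∫ v : F, Real.exp (-b * ‖v‖ ^ 2) : ℝ) : ℂ) := by
    rw [← integral_complex_ofReal]
    congr 1; ext v; push_cast; ring_nf
  have h4 : Complex.exp (Complex.I ^ 2 * (‖q‖ : ℂ) ^ 2 / (4 * b))
      = ((Real.exp (-(‖q‖ ^ 2) / (4 * b)) : ℝ) : ℂ) := by
    rw [Complex.I_sq]; push_cast; congr 1; ring
  rw [← h2, h3, h4, ← Complex.ofReal_mul] at h1
  have h5 := congrArg Complex.re h1
  rw [Complex.ofReal_re] at h5
  rw [← h5]
  have hi := GaussianFourier.integrable_cexp_neg_mul_sq_norm_add hb' Complex.I q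
  have h6 := integral_re hi
  simp only [RCLike.re_to_complex] at h6
  rw [← h6]
  congr 1; ext v
  have e : (-(b : ℂ) * (‖v‖ : ℂ) ^ 2 + Complex.I * ((inner ℝ q v : ℝ) : ℂ))
      = ((-b * ‖v‖ ^ 2 : ℝ) : ℂ) + ((inner ℝ q v : ℝ) : ℂ) * Complex.I := by push_cast; ring
  rw [e, Complex.exp_add, ← Complex.ofReal_exp, Complex.re_ofReal_mul, Complex.exp_ofReal_mul_I_re,
    real_inner_comm]

/-! #### the kernel `(1 - cos t)/t²` -/

theorem cosk_bound (s t : ℝ) : (1 - Real.cos (t * s)) / t ^ 2 ≤ (s ^ 2 / 2 + 2) * (1 + t ^ 2)⁻¹ := by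
  by_cases ht : t = 0
  · subst ht; simp; positivity
  · have ht2 : 0 < t ^ 2 := by positivity
    have h1 := Real.one_sub_sq_div_two_le_cos (x := t * s)
    have h2 := Real.neg_one_le_cos (t * s)
    rw [div_le_iff₀ ht2, mul_assoc, inv_mul_eq_div, ← mul_div_assoc, le_div_iff₀ (by positivity)]
    nlinarith

theorem cosk_nonneg (s t : ℝ) : 0 ≤ (1 - Real.cos (t * s)) / t ^ 2 :=
  div_nonneg (by have := Real.cos_le_one (t * s); linarith) (by positivity)

theorem cosk_integrable (s : ℝ) : Integrable (fun t : ℝ => (1 - Real.cos (t * s)) / t ^ 2) := by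
  refine (integrable_inv_one_add_sq.const_mul (s ^ 2 / 2 + 2)).mono'
    (Measurable.aestronglyMeasurable (by fun_prop)) ?_
  filter_upwards with t
  rw [Real.norm_of_nonneg (cosk_nonneg s t)]
  exact cosk_bound s t

/-- the constant `∫ (1 - cos t)/t²` -/
def czero : ℝ := ∫ t : ℝ, (1 - Real.cos (t * 1)) / t ^ 2

theorem czero_pos : 0 < czero := by
  unfold czero
  rw [integral_pos_iff_support_of_nonneg (fun t => cosk_nonneg 1 t) (cosk_integrable 1)]
  have hsub : Ioo (0 : ℝ) 1 ⊆ Function.support (fun t : ℝ => (1 - Real.cos (t * 1)) / t ^ 2) := by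
    intro t ht
    rw [Function.mem_support]
    have h1 : Real.cos t < 1 := by
      have := Real.cos_lt_cos_of_nonneg_of_le_pi (x := 0) (y := t) le_rfl
        (by have := Real.pi_gt_three; linarith [ht.2]) ht.1
      simpa using this
    have h2 : 0 < t ^ 2 := pow_pos ht.1 2
    rw [mul_one]
    exact (div_pos (by linarith) h2).ne'
  refine lt_of_lt_of_le ?_ (measure_mono hsub)
  simp

theorem cosk_integral (s : ℝ) : ∫ t : ℝ, (1 - Real.cos (t * s)) / t ^ 2 = czero * |s| := by
  by_cases hs : s = 0
  · subst hs; simp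
  · have h := Measure.integral_comp_mul_right (fun t : ℝ => (1 - Real.cos (t * 1)) / t ^ 2) s
    have e : ∀ t : ℝ, (1 - Real.cos (t * s)) / t ^ 2
        = s ^ 2 * ((1 - Real.cos (t * s * 1)) / (t * s) ^ 2) := by
      intro t
      rw [mul_one, mul_pow]
      by_cases ht : t = 0
      · simp [ht]
      · field_simp
    simp_rw [e]
    rw [integral_const_mul, h, smul_eq_mul]
    change s ^ 2 * (|s⁻¹| * czero) = _
    rw [abs_inv]
    have : |s| ≠ 0 := abs_ne_zero.2 hs
    rw [← sq_abs]
    field_simp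

/-! #### the explicit densities -/

/-- Gaussian density with a cosine factor -/
def fk (α : ℝ) (y u : F) : ℝ :=
  Real.exp (‖y‖ ^ 2 / α) / (∫ v : F, Real.exp (-(1 / (4 * α)) * ‖v‖ ^ 2))
    * (Real.exp (-(1 / (4 * α)) * ‖u‖ ^ 2) * Real.cos (inner ℝ u y / α))

theorem fk_abs_le {α : ℝ} (hα : 0 < α) (y u : F) :
    |fk α y u| ≤ Real.exp (‖y‖ ^ 2 / α) / (∫ v : F, Real.exp (-(1 / (4 * α)) * ‖v‖ ^ 2))
      * Real.exp (-(1 / (4 * α)) * ‖u‖ ^ 2) := by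
  have h0 : 0 < ∫ v : F, Real.exp (-(1 / (4 * α)) * ‖v‖ ^ 2) := gauss_pos (by positivity)
  unfold fk
  rw [abs_mul, abs_of_pos (by positivity), abs_mul, abs_of_pos (Real.exp_pos _)]
  gcongr
  exact mul_le_of_le_one_right (Real.exp_pos _).le (Real.abs_cos_le_one _)

theorem fk_continuous (α : ℝ) : Continuous (fun p : F × F => fk α p.1 p.2) := by
  unfold fk
  fun_prop

theorem fk_continuous_right (α : ℝ) (y : F) : Continuous (fun u : F => fk α y u) := by
  unfold fk
  fun_prop

theorem fk_integrable_sq {α : ℝ} (hα : 0 < α) (y : F) :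
    Integrable (fun u : F => fk α y u * (1 + ‖u‖ ^ 2)) := by
  refine ((gauss_integrable_sq (F := F) (b := 1 / (4 * α)) (by positivity)).const_mul
    (Real.exp (‖y‖ ^ 2 / α) / (∫ v : F, Real.exp (-(1 / (4 * α)) * ‖v‖ ^ 2)))).mono'
    ((fk_continuous_right α y).mul (by fun_prop)).aestronglyMeasurable ?_
  filter_upwards with u
  rw [Real.norm_eq_abs, abs_mul, abs_of_pos (a := 1 + ‖u‖ ^ 2) (by positivity)]
  have := fk_abs_le hα y u
  exact (mul_le_mul_of_nonneg_right this (by positivity)).trans (le_of_eq (by ring))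

theorem fk_integrable {α : ℝ} (hα : 0 < α) (y : F) {g : F → ℝ} (hg : AEStronglyMeasurable g)
    (hb : ∀ u, |g u| ≤ 1 + ‖u‖ ^ 2) : Integrable (fun u : F => fk α y u * g u) := by
  refine (fk_integrable_sq hα y).norm.mono'
    ((fk_continuous_right α y).aestronglyMeasurable.mul hg) ?_
  filter_upwards with u
  rw [Real.norm_eq_abs, abs_mul, Real.norm_eq_abs, abs_mul]
  refine mul_le_mul_of_nonneg_left ((hb u).trans (le_abs_self _)) (abs_nonneg _)

theorem fk_hat {α : ℝ} (hα : 0 < α) (y z : F) :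
    ∫ u : F, fk α y u * Real.cos (inner ℝ u z)
      = Real.exp (-α * ‖z‖ ^ 2) * Real.cosh (2 * inner ℝ z y) := by
  have hb : 0 < 1 / (4 * α) := by positivity
  set G := ∫ v : F, Real.exp (-(1 / (4 * α)) * ‖v‖ ^ 2) with hG
  have hG0 : 0 < G := gauss_pos hb
  have hi : ∀ q : F, Integrable
      (fun u : F => Real.exp (-(1 / (4 * α)) * ‖u‖ ^ 2) * Real.cos (inner ℝ u q)) := by
    intro q
    refine (gauss_integrable (F := F) hb).mono' (by fun_prop) ?_
    filter_upwards with u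
    rw [Real.norm_eq_abs, abs_mul, abs_of_pos (Real.exp_pos _)]
    exact mul_le_of_le_one_right (Real.exp_pos _).le (Real.abs_cos_le_one _)
  have e : ∀ u : F, fk α y u * Real.cos (inner ℝ u z)
      = Real.exp (‖y‖ ^ 2 / α) / G / 2 *
        (Real.exp (-(1 / (4 * α)) * ‖u‖ ^ 2) * Real.cos (inner ℝ u (α⁻¹ • y + z))
         + Real.exp (-(1 / (4 * α)) * ‖u‖ ^ 2) * Real.cos (inner ℝ u (α⁻¹ • y - z))) := by
    intro u
    rw [inner_add_right, inner_sub_right, Real.cos_add, Real.cos_sub, inner_smul_right]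
    unfold fk
    rw [← hG, div_eq_inv_mul (inner ℝ u y) α]
    ring
  simp_rw [e]
  rw [integral_const_mul, integral_add (hi _) (hi _), gauss_cos hb, gauss_cos hb, ← hG,
    Real.cosh_eq]
  have n1 : -(‖α⁻¹ • y + z‖ ^ 2) / (4 * (1 / (4 * α)))
      = -(‖y‖ ^ 2 / α) + (-α * ‖z‖ ^ 2) + -(2 * inner ℝ z y) := by
    rw [norm_add_sq_real, norm_smul, inner_smul_left, norm_inv, Real.norm_of_nonneg hα.le,
      real_inner_comm y z]
    simp only [conj_trivial]
    field_simp
    ring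
  have n2 : -(‖α⁻¹ • y - z‖ ^ 2) / (4 * (1 / (4 * α)))
      = -(‖y‖ ^ 2 / α) + (-α * ‖z‖ ^ 2) + (2 * inner ℝ z y) := by
    rw [norm_sub_sq_real, norm_smul, inner_smul_left, norm_inv, Real.norm_of_nonneg hα.le,
      real_inner_comm y z]
    simp only [conj_trivial]
    field_simp
    ring
  rw [n1, n2, Real.exp_add, Real.exp_add, Real.exp_add, Real.exp_add, Real.exp_neg (‖y‖ ^ 2 / α)]
  have := (Real.exp_pos (‖y‖ ^ 2 / α)).ne'
  field_simp
  ring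

theorem fk_cosine {α : ℝ} (hα : 0 < α) (y x : F) (hx : ‖x‖ = 1) :
    Integrable (fun t : ℝ =>
      (1 - Real.exp (-α * t ^ 2) * Real.cosh (2 * (t * inner ℝ x y))) / t ^ 2) ∧
    ∫ t : ℝ, (1 - Real.exp (-α * t ^ 2) * Real.cosh (2 * (t * inner ℝ x y))) / t ^ 2
      = czero * ∫ u : F, fk α y u * |inner ℝ u x| := by
  have hin : ∀ u : F, (inner ℝ u x) ^ 2 ≤ ‖u‖ ^ 2 := by
    intro u
    have := abs_real_inner_le_norm u x
    rw [hx, mul_one] at this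
    rw [← sq_abs]; gcongr
  have hI : Integrable (fun p : ℝ × F =>
      fk α y p.2 * ((1 - Real.cos (p.1 * inner ℝ p.2 x)) / p.1 ^ 2)) (volume.prod volume) := by
    have hb := (integrable_inv_one_add_sq.const_mul 2).mul_prod
      ((fk_integrable_sq hα y).norm)
    refine hb.mono' ?_ ?_
    · have m1 : Measurable (fun p : ℝ × F => fk α y p.2) :=
        ((fk_continuous_right α y).comp continuous_snd).measurable
      have m2 : Measurable (fun p : ℝ × F => 1 - Real.cos (p.1 * inner ℝ p.2 x)) :=
        Continuous.measurable (by fun_prop)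
      exact (m1.mul (m2.div (measurable_fst.pow_const 2))).aestronglyMeasurable
    · filter_upwards with p
      rw [Real.norm_eq_abs, abs_mul, abs_of_nonneg (cosk_nonneg _ _), Real.norm_eq_abs, abs_mul,
        abs_of_pos (a := 1 + ‖p.2‖ ^ 2) (by positivity)]
      have h1 := cosk_bound (inner ℝ p.2 x) p.1
      have h2 : (inner ℝ p.2 x ^ 2 / 2 + 2) ≤ 2 * (1 + ‖p.2‖ ^ 2) := by
        have := hin p.2; nlinarith [sq_nonneg ‖p.2‖]
      calc |fk α y p.2| * ((1 - Real.cos (p.1 * inner ℝ p.2 x)) / p.1 ^ 2)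
          ≤ |fk α y p.2| * ((2 * (1 + ‖p.2‖ ^ 2)) * (1 + p.1 ^ 2)⁻¹) := by
            gcongr
            exact h1.trans (by gcongr)
        _ = _ := by ring
  have hinner : ∀ t : ℝ, ∫ u : F, fk α y u * ((1 - Real.cos (t * inner ℝ u x)) / t ^ 2)
      = (1 - Real.exp (-α * t ^ 2) * Real.cosh (2 * (t * inner ℝ x y))) / t ^ 2 := by
    intro t
    have h0 := fk_hat hα y (0 : F)
    have h1 := fk_hat hα y (t • x)
    simp only [inner_zero_right, Real.cos_zero, norm_zero, inner_zero_left, mul_zero,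
      Real.cosh_zero, mul_one] at h0
    norm_num at h0
    rw [norm_smul, hx, mul_one, Real.norm_eq_abs, sq_abs] at h1
    simp only [inner_smul_right, inner_smul_left, conj_trivial] at h1
    suffices h2 : ∫ u : F, fk α y u * ((1 - Real.cos (t * inner ℝ u x)) / t ^ 2)
        = ((∫ u : F, fk α y u) - ∫ u : F, fk α y u * Real.cos (t * inner ℝ u x)) / t ^ 2 by
      rw [h2, h0, h1]
    rw [← integral_sub, ← integral_div]
    · congr 1; ext u; ring
    · simpa using fk_integrable hα y (g := fun _ => 1) (by fun_prop)
        (fun u => by simp)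
    · apply fk_integrable hα y (by fun_prop)
      intro u
      refine (Real.abs_cos_le_one _).trans ?_
      nlinarith [sq_nonneg ‖u‖]
  constructor
  · exact hI.integral_prod_left.congr (by filter_upwards with t; exact hinner t)
  · simp_rw [← hinner]
    rw [integral_integral_swap hI, ← integral_const_mul]
    congr 1; ext u
    rw [integral_const_mul, cosk_integral]
    ring

end GaussianPart

/-! ### Smoothing of symmetric bodies -/
section Smoothing

/-- weight in the radial variable -/
def wt (a t : ℝ) : ℝ := (Real.exp (-a * t ^ 2) - Real.exp (-(2 * a) * t ^ 2)) / t ^ 2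

theorem wt_nonneg {a : ℝ} (ha : 0 < a) (t : ℝ) : 0 ≤ wt a t := by
  apply div_nonneg _ (by positivity)
  rw [sub_nonneg]
  apply Real.exp_le_exp.2
  nlinarith [sq_nonneg t, mul_nonneg ha.le (sq_nonneg t)]

theorem wt_le {a : ℝ} (ha : 0 < a) (t : ℝ) : wt a t ≤ a * Real.exp (-a * t ^ 2) := by
  by_cases ht : t = 0
  · subst ht; simp [wt]; exact ha.le
  · unfold wt
    rw [div_le_iff₀ (by positivity)]
    have e : Real.exp (-(2 * a) * t ^ 2) = Real.exp (-a * t ^ 2) * Real.exp (-a * t ^ 2) := by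
      rw [← Real.exp_add]; congr 1; ring
    have h1 := Real.add_one_le_exp (-a * t ^ 2)
    rw [e]
    nlinarith [Real.exp_pos (-a * t ^ 2)]

theorem wt_measurable (a : ℝ) : Measurable (wt a) := by
  unfold wt
  fun_prop

theorem wt_integrable_sq {a : ℝ} (ha : 0 < a) : Integrable (fun t : ℝ => wt a t * (1 + t ^ 2)) := by
  refine ((gauss_integrable_sq (F := ℝ) ha).const_mul a).mono'
    ((wt_measurable a).mul (by fun_prop)).aestronglyMeasurable ?_
  filter_upwards with t
  rw [Real.norm_of_nonneg (mul_nonneg (wt_nonneg ha t) (by positivity)), Real.norm_eq_abs, sq_abs]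
  have := wt_le ha t
  nlinarith [sq_nonneg t]

theorem wt_integrable {a : ℝ} (ha : 0 < a) {g : ℝ → ℝ} (hg : Measurable g)
    (hb : ∀ t, |g t| ≤ 1 + t ^ 2) : Integrable (fun t : ℝ => wt a t * g t) := by
  refine (wt_integrable_sq ha).mono' ((wt_measurable a).mul hg).aestronglyMeasurable ?_
  filter_upwards with t
  rw [Real.norm_eq_abs, abs_mul, abs_of_nonneg (wt_nonneg ha t)]
  exact mul_le_mul_of_nonneg_left (hb t) (wt_nonneg ha t)

theorem wt_scale {ε : ℝ} (hε : 0 < ε) (t : ℝ) : wt (ε ^ 2) t = ε ^ 2 * wt 1 (t * ε) := by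
  unfold wt
  by_cases ht : t = 0
  · simp [ht]
  · have e1 : -(1 : ℝ) * (t * ε) ^ 2 = -ε ^ 2 * t ^ 2 := by ring
    have e2 : -(2 * 1 : ℝ) * (t * ε) ^ 2 = -(2 * ε ^ 2) * t ^ 2 := by ring
    rw [e1, e2]
    field_simp

theorem wt_int_one {ε : ℝ} (hε : 0 < ε) : ∫ t, wt (ε ^ 2) t = ε * ∫ t, wt 1 t := by
  simp_rw [wt_scale hε]
  rw [integral_const_mul, Measure.integral_comp_mul_right, abs_of_pos (inv_pos.2 hε), smul_eq_mul]
  field_simp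

theorem wt_int_abs {ε : ℝ} (hε : 0 < ε) : ∫ t, wt (ε ^ 2) t * |t| = ∫ t, wt 1 t * |t| := by
  have e : ∀ t : ℝ, wt (ε ^ 2) t * |t| = ε * (wt 1 (t * ε) * |t * ε|) := by
    intro t
    rw [wt_scale hε, abs_mul, abs_of_pos hε]; ring
  simp_rw [e]
  rw [integral_const_mul, Measure.integral_comp_mul_right (fun t => wt 1 t * |t|),
    abs_of_pos (inv_pos.2 hε), smul_eq_mul]
  field_simp

theorem abs_le_one_add_sq (t : ℝ) : |t| ≤ 1 + t ^ 2 := by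
  rw [← sq_abs]; nlinarith [sq_nonneg (|t| - 1), abs_nonneg t]

theorem wt_abs_pos : 0 < ∫ t, wt 1 t * |t| := by
  rw [integral_pos_iff_support_of_nonneg
    (fun t => mul_nonneg (wt_nonneg one_pos t) (abs_nonneg t))
    (wt_integrable one_pos (by fun_prop) (fun t => by rw [abs_abs]; exact abs_le_one_add_sq t))]
  have hsub : Ioo (0 : ℝ) 1 ⊆ Function.support (fun t : ℝ => wt 1 t * |t|) := by
    intro t ht
    rw [Function.mem_support]
    have h2 : 0 < t ^ 2 := pow_pos ht.1 2
    have h1 : Real.exp (-(2 * 1) * t ^ 2) < Real.exp (-1 * t ^ 2) :=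
      Real.exp_lt_exp.2 (by linarith)
    exact (mul_pos (div_pos (by linarith) h2) (abs_pos.2 ht.1.ne')).ne'
  refine lt_of_lt_of_le ?_ (measure_mono hsub)
  simp

variable {F : Type*} [NormedAddCommGroup F] [InnerProductSpace ℝ F]

/-- two-sided perturbation of the support function -/
def qf (S : ConvexBody F) (t : ℝ) (g x : F) : ℝ :=
  sf S (t • x + ‖x‖ • g) + sf S (t • x - ‖x‖ • g)

theorem sf_mono_radius (S : ConvexBody F) (z g : F) {r R : ℝ} (hr : 0 ≤ r) (hR : r ≤ R) :
    sf S (z + r • g) + sf S (z - r • g) ≤ sf S (z + R • g) + sf S (z - R • g) := by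
  rcases hr.eq_or_lt with h0 | h0
  · subst h0
    have h1 := sf_subadd S (z + R • g) (z - R • g)
    have e : z + R • g + (z - R • g) = (2 : ℝ) • z := by rw [two_smul]; abel
    rw [e, sf_homog S (by norm_num)] at h1
    simp only [zero_smul, add_zero, sub_zero]
    linarith
  · have hRp : 0 < R := h0.trans_le hR
    have l1 : 0 ≤ (1 + r / R) / 2 := by positivity
    have l2 : 0 ≤ (1 - r / R) / 2 := by
      have : r / R ≤ 1 := (div_le_one hRp).2 hR
      linarith
    have e : r / R * R = r := by field_simp
    have e1 : z + r • g = ((1 + r / R) / 2) • (z + R • g) + ((1 - r / R) / 2) • (z - R • g) := by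
      have : r • g = (r / R) • (R • g) := by rw [smul_smul, e]
      rw [this]; module
    have e2 : z - r • g = ((1 - r / R) / 2) • (z + R • g) + ((1 + r / R) / 2) • (z - R • g) := by
      have : r • g = (r / R) • (R • g) := by rw [smul_smul, e]
      rw [this]; module
    have h1 := sf_subadd S (((1 + r / R) / 2) • (z + R • g)) (((1 - r / R) / 2) • (z - R • g))
    have h2 := sf_subadd S (((1 - r / R) / 2) • (z + R • g)) (((1 + r / R) / 2) • (z - R • g))
    rw [sf_homog S l1, sf_homog S l2] at h1 h2
    rw [e1, e2]
    linarith

theorem qf_subadd (S : ConvexBody F) (t : ℝ) (g x y : F) :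
    qf S t g (x + y) ≤ qf S t g x + qf S t g y := by
  have h1 := sf_mono_radius S (t • (x + y)) g (norm_nonneg _) (norm_add_le x y)
  have h2 := sf_subadd S (t • x + ‖x‖ • g) (t • y + ‖y‖ • g)
  have h3 := sf_subadd S (t • x - ‖x‖ • g) (t • y - ‖y‖ • g)
  have e2 : t • x + ‖x‖ • g + (t • y + ‖y‖ • g) = t • (x + y) + (‖x‖ + ‖y‖) • g := by module
  have e3 : t • x - ‖x‖ • g + (t • y - ‖y‖ • g) = t • (x + y) - (‖x‖ + ‖y‖) • g := by module
  rw [e2] at h2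
  rw [e3] at h3
  unfold qf
  linarith

theorem qf_homog (S : ConvexBody F) (t : ℝ) (g x : F) {c : ℝ} (hc : 0 < c) :
    qf S t g (c • x) = c * qf S t g x := by
  unfold qf
  rw [norm_smul, Real.norm_of_nonneg hc.le, mul_add, ← sf_homog S hc.le, ← sf_homog S hc.le]
  congr 2 <;> module

theorem qf_bound (S : ConvexBody F) {R : ℝ} (hR0 : 0 ≤ R) (hR : ∀ u, |sf S u| ≤ R * ‖u‖)
    (t : ℝ) (g x : F) : |qf S t g x| ≤ 2 * R * ‖x‖ * ((1 + t ^ 2) * (1 + ‖g‖ ^ 2)) := by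
  have n1 : ‖t • x + ‖x‖ • g‖ ≤ ‖x‖ * (|t| + ‖g‖) := by
    refine (norm_add_le _ _).trans ?_
    rw [norm_smul, norm_smul, norm_norm, Real.norm_eq_abs]
    linarith
  have n2 : ‖t • x - ‖x‖ • g‖ ≤ ‖x‖ * (|t| + ‖g‖) := by
    refine (norm_sub_le _ _).trans ?_
    rw [norm_smul, norm_smul, norm_norm, Real.norm_eq_abs]
    linarith
  have h3 : |t| + ‖g‖ ≤ (1 + t ^ 2) * (1 + ‖g‖ ^ 2) := by
    rw [← sq_abs t]
    nlinarith [sq_nonneg (|t| - 1/2), sq_nonneg (‖g‖ - 1/2), sq_nonneg (|t| * ‖g‖)]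
  have h1 := (hR (t • x + ‖x‖ • g)).trans (mul_le_mul_of_nonneg_left n1 hR0)
  have h2 := (hR (t • x - ‖x‖ • g)).trans (mul_le_mul_of_nonneg_left n2 hR0)
  have h4 : R * (‖x‖ * (|t| + ‖g‖)) ≤ R * (‖x‖ * ((1 + t ^ 2) * (1 + ‖g‖ ^ 2))) := by gcongr
  refine (abs_add_le _ _).trans ?_
  linarith

theorem qf_near (S : ConvexBody F) {R : ℝ}
    (hR : ∀ u v, |sf S u - sf S v| ≤ R * ‖u - v‖) (hev : ∀ u, sf S (-u) = sf S u)
    (t : ℝ) (g x : F) : |qf S t g x - 2 * (|t| * sf S x)| ≤ 2 * (R * (‖x‖ * ‖g‖)) := by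
  have h0 : |t| * sf S x = sf S (t • x) := by
    rw [← sf_homog S (abs_nonneg t)]
    rcases abs_choice t with h | h
    · rw [h]
    · rw [h, neg_smul, hev]
  have h1 := hR (t • x + ‖x‖ • g) (t • x)
  have h2 := hR (t • x - ‖x‖ • g) (t • x)
  rw [add_sub_cancel_left, norm_smul, norm_norm] at h1
  have e : t • x - ‖x‖ • g - t • x = -(‖x‖ • g) := by abel
  rw [e, norm_neg, norm_smul, norm_norm] at h2
  rw [h0]
  unfold qf
  rw [abs_le] at *
  constructor <;> linarith

theorem qf_continuous (S : ConvexBody F) (x : F) :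
    Continuous (fun p : ℝ × F => qf S p.1 p.2 x) := by
  unfold qf
  exact ((sf_continuous S).comp (by fun_prop)).add ((sf_continuous S).comp (by fun_prop))

variable [FiniteDimensional ℝ F] [MeasurableSpace F] [BorelSpace F]

theorem om_integrable {a : ℝ} (ha : 0 < a) {q : ℝ × F → ℝ} (hq : Measurable q) {C : ℝ}
    (hb : ∀ p, |q p| ≤ C * ((1 + p.1 ^ 2) * (1 + ‖p.2‖ ^ 2))) :
    Integrable (fun p : ℝ × F => wt a p.1 * Real.exp (-1 * ‖p.2‖ ^ 2) * q p)
      (volume.prod volume) := by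
  refine (((wt_integrable_sq ha).mul_prod (gauss_integrable_sq (F := F) one_pos)).const_mul C).mono'
    ?_ ?_
  · have m1 : Measurable (fun p : ℝ × F => wt a p.1) := (wt_measurable a).comp measurable_fst
    have m2 : Measurable (fun p : ℝ × F => Real.exp (-1 * ‖p.2‖ ^ 2)) :=
      Continuous.measurable (by fun_prop)
    exact ((m1.mul m2).mul hq).aestronglyMeasurable
  · filter_upwards with p
    rw [Real.norm_eq_abs, abs_mul, abs_of_nonneg
      (mul_nonneg (wt_nonneg ha _) (Real.exp_pos _).le)]
    refine (mul_le_mul_of_nonneg_left (hb p)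
      (mul_nonneg (wt_nonneg ha _) (Real.exp_pos _).le)).trans (le_of_eq ?_)
    ring

/-- the smoothed support function -/
def Tf (S : ConvexBody F) (a : ℝ) (x : F) : ℝ :=
  ∫ p : ℝ × F, wt a p.1 * Real.exp (-1 * ‖p.2‖ ^ 2) * qf S p.1 p.2 x ∂(volume.prod volume)

theorem Tf_integrable (S : ConvexBody F) {a : ℝ} (ha : 0 < a) (x : F) :
    Integrable (fun p : ℝ × F => wt a p.1 * Real.exp (-1 * ‖p.2‖ ^ 2) * qf S p.1 p.2 x)
      (volume.prod volume) := by
  obtain ⟨R, hR0, hR⟩ := exists_sf_bound S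
  exact om_integrable ha (qf_continuous S x).measurable (fun p => qf_bound S hR0 hR p.1 p.2 x)

theorem exists_Tf_body (S : ConvexBody F) {a : ℝ} (ha : 0 < a) :
    ∃ S' : ConvexBody F, ∀ x, sf S' x = Tf S a x := by
  have om0 : ∀ p : ℝ × F, 0 ≤ wt a p.1 * Real.exp (-1 * ‖p.2‖ ^ 2) :=
    fun p => mul_nonneg (wt_nonneg ha _) (Real.exp_pos _).le
  apply exists_body
  · intro u v
    unfold Tf
    rw [← integral_add (Tf_integrable S ha u) (Tf_integrable S ha v)]
    refine integral_mono (Tf_integrable S ha _)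
      ((Tf_integrable S ha u).add (Tf_integrable S ha v)) (fun p => ?_)
    simp only [Pi.add_apply]
    rw [← mul_add]
    exact mul_le_mul_of_nonneg_left (qf_subadd S _ _ _ _) (om0 p)
  · intro c hc u
    unfold Tf
    rw [← integral_const_mul]
    congr 1; ext p
    rw [qf_homog S _ _ _ hc]; ring
  · obtain ⟨R, hR0, hR⟩ := exists_sf_bound S
    have hi : Integrable (fun p : ℝ × F => wt a p.1 * Real.exp (-1 * ‖p.2‖ ^ 2)
        * ((1 + p.1 ^ 2) * (1 + ‖p.2‖ ^ 2))) (volume.prod volume) :=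
      om_integrable (C := 1) ha (Continuous.measurable (by fun_prop))
        (fun p => by rw [abs_of_nonneg (by positivity), one_mul])
    refine ⟨∫ p : ℝ × F, 2 * R * (wt a p.1 * Real.exp (-1 * ‖p.2‖ ^ 2)
        * ((1 + p.1 ^ 2) * (1 + ‖p.2‖ ^ 2))) ∂(volume.prod volume), fun u => ?_⟩
    unfold Tf
    rw [← integral_mul_const]
    refine integral_mono (Tf_integrable S ha u) ((hi.const_mul _).mul_const _) (fun p => ?_)
    refine (mul_le_mul_of_nonneg_left ((le_abs_self _).trans (qf_bound S hR0 hR p.1 p.2 u))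
      (om0 p)).trans (le_of_eq ?_)
    ring

theorem Tf_near (S : ConvexBody F) {R : ℝ}
    (hR : ∀ u v, |sf S u - sf S v| ≤ R * ‖u - v‖) (hev : ∀ u, sf S (-u) = sf S u)
    {ε : ℝ} (hε : 0 < ε) (x : F) :
    |Tf S (ε ^ 2) x - 2 * (∫ t, wt 1 t * |t|) * (∫ g : F, Real.exp (-1 * ‖g‖ ^ 2)) * sf S x|
      ≤ 2 * R * (∫ t, wt 1 t) * (∫ g : F, Real.exp (-1 * ‖g‖ ^ 2) * ‖g‖) * ε * ‖x‖ := by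
  have ha : 0 < ε ^ 2 := by positivity
  have om0 : ∀ p : ℝ × F, 0 ≤ wt (ε ^ 2) p.1 * Real.exp (-1 * ‖p.2‖ ^ 2) :=
    fun p => mul_nonneg (wt_nonneg ha _) (Real.exp_pos _).le
  have e1 : 2 * (∫ t, wt 1 t * |t|) * (∫ g : F, Real.exp (-1 * ‖g‖ ^ 2)) * sf S x
      = ∫ p : ℝ × F, wt (ε ^ 2) p.1 * Real.exp (-1 * ‖p.2‖ ^ 2) * (2 * (|p.1| * sf S x))
        ∂(volume.prod volume) := by
    rw [← wt_int_abs hε]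
    have := integral_prod_mul (μ := (volume : Measure ℝ)) (ν := (volume : Measure F))
      (fun t => wt (ε ^ 2) t * |t|) (fun g => Real.exp (-1 * ‖g‖ ^ 2))
    rw [mul_assoc 2, ← this, mul_comm 2, mul_assoc, ← integral_mul_const]
    congr 1; ext p; ring
  have e2 : 2 * R * (∫ t, wt 1 t) * (∫ g : F, Real.exp (-1 * ‖g‖ ^ 2) * ‖g‖) * ε * ‖x‖
      = ∫ p : ℝ × F, wt (ε ^ 2) p.1 * Real.exp (-1 * ‖p.2‖ ^ 2) * (2 * (R * (‖x‖ * ‖p.2‖)))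
        ∂(volume.prod volume) := by
    have h1 := wt_int_one hε
    have := integral_prod_mul (μ := (volume : Measure ℝ)) (ν := (volume : Measure F))
      (fun t => wt (ε ^ 2) t) (fun g => Real.exp (-1 * ‖g‖ ^ 2) * ‖g‖)
    rw [h1] at this
    have h2 : 2 * R * (∫ t, wt 1 t) * (∫ g : F, Real.exp (-1 * ‖g‖ ^ 2) * ‖g‖) * ε * ‖x‖
      = ((ε * ∫ t, wt 1 t) * (∫ g : F, Real.exp (-1 * ‖g‖ ^ 2) * ‖g‖)) * (2 * R * ‖x‖) := by ring
    rw [h2, ← this, ← integral_mul_const]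
    congr 1; ext p; ring
  have i1 : Integrable (fun p : ℝ × F => wt (ε ^ 2) p.1 * Real.exp (-1 * ‖p.2‖ ^ 2)
      * (2 * (|p.1| * sf S x))) (volume.prod volume) := by
    apply om_integrable (C := 2 * |sf S x|) ha (Continuous.measurable (by fun_prop))
    intro p
    rw [abs_mul, abs_mul, abs_abs, abs_two]
    have h1 := abs_le_one_add_sq p.1
    have h2 : 1 + p.1 ^ 2 ≤ (1 + p.1 ^ 2) * (1 + ‖p.2‖ ^ 2) :=
      le_mul_of_one_le_right (by positivity) (by nlinarith [sq_nonneg ‖p.2‖])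
    have h3 := mul_le_mul_of_nonneg_left (h1.trans h2) (abs_nonneg (sf S x))
    linarith
  have i2 : Integrable (fun p : ℝ × F => wt (ε ^ 2) p.1 * Real.exp (-1 * ‖p.2‖ ^ 2)
      * (2 * (R * (‖x‖ * ‖p.2‖)))) (volume.prod volume) := by
    apply om_integrable (C := 2 * |R| * ‖x‖) ha (Continuous.measurable (by fun_prop))
    intro p
    rw [abs_mul, abs_mul, abs_mul, abs_norm, abs_norm, abs_two]
    have h1 := abs_le_one_add_sq ‖p.2‖
    rw [abs_norm] at h1
    have h2 : 1 + ‖p.2‖ ^ 2 ≤ (1 + p.1 ^ 2) * (1 + ‖p.2‖ ^ 2) :=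
      le_mul_of_one_le_left (by positivity) (by nlinarith [sq_nonneg p.1])
    have h3 := mul_le_mul_of_nonneg_left (h1.trans h2)
      (mul_nonneg (abs_nonneg R) (norm_nonneg x))
    linarith
  rw [e1, e2]
  unfold Tf
  rw [← integral_sub (Tf_integrable S ha x) i1]
  refine abs_integral_le_integral_abs.trans ?_
  refine integral_mono ((Tf_integrable S ha x).sub i1).abs i2 (fun p => ?_)
  simp only
  rw [← mul_sub, abs_mul, abs_of_nonneg (om0 p)]
  exact mul_le_mul_of_nonneg_left (qf_near S hR hev _ _ _) (om0 p)

end Smoothing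

/-! ### Symmetric bodies -/
section SymmetricBodies

variable {F : Type*} [NormedAddCommGroup F] [InnerProductSpace ℝ F]
  [FiniteDimensional ℝ F] [MeasurableSpace F] [BorelSpace F]

theorem exp_mix_le {a : ℝ} (ha : 0 < a) (x y : F) (hx : ‖x‖ = 1) (t : ℝ) :
    Real.exp (-a * t ^ 2) * Real.exp (-1 * ‖y - t • x‖ ^ 2)
      ≤ Real.exp (-(a / 2) * t ^ 2) * Real.exp (-(1 - (1 + a / 2)⁻¹) * ‖y‖ ^ 2) := by
  rw [← Real.exp_add, ← Real.exp_add]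
  apply Real.exp_le_exp.2
  have hm : 0 < 1 + a / 2 := by positivity
  have h1 : ‖y - t • x‖ ^ 2 = ‖y‖ ^ 2 - 2 * (t * inner ℝ y x) + t ^ 2 := by
    rw [norm_sub_sq_real, inner_smul_right, norm_smul, hx, mul_one, Real.norm_eq_abs, sq_abs]
  have h2 : (inner ℝ y x) ^ 2 ≤ ‖y‖ ^ 2 := by
    have := abs_real_inner_le_norm y x
    rw [hx, mul_one] at this
    rw [← sq_abs]; gcongr
  have h3 : 2 * (t * inner ℝ y x) ≤ (1 + a / 2) * t ^ 2 + (1 + a / 2)⁻¹ * ‖y‖ ^ 2 := by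
    have e : (1 + a / 2) * t ^ 2 + (1 + a / 2)⁻¹ * (inner ℝ y x) ^ 2 - 2 * (t * inner ℝ y x)
        = (1 + a / 2)⁻¹ * ((1 + a / 2) * t - inner ℝ y x) ^ 2 := by
      field_simp
      ring
    have e1 : 0 ≤ (1 + a / 2)⁻¹ * ((1 + a / 2) * t - inner ℝ y x) ^ 2 := by positivity
    have e2 : (1 + a / 2)⁻¹ * (inner ℝ y x) ^ 2 ≤ (1 + a / 2)⁻¹ * ‖y‖ ^ 2 := by gcongr
    linarith
  rw [h1]
  nlinarith

theorem mix_integrable (S : ConvexBody F) {a : ℝ} (ha : 0 < a) (x : F) (hx : ‖x‖ = 1) :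
    Integrable (fun p : ℝ × F => wt a p.1 * Real.exp (-1 * ‖p.2 - p.1 • x‖ ^ 2) * sf S p.2)
      (volume.prod volume) := by
  obtain ⟨R, hR0, hR⟩ := exists_sf_bound S
  have hc : 0 < 1 - (1 + a / 2)⁻¹ := by
    have : (1 + a / 2)⁻¹ < 1 := inv_lt_one_of_one_lt₀ (by linarith)
    linarith
  have hb := ((gauss_integrable (F := ℝ) (half_pos ha)).mul_prod
    (gauss_integrable_sq (F := F) hc)).const_mul (a * R)
  refine hb.mono' ?_ ?_
  · have m1 : Measurable (fun p : ℝ × F => wt a p.1) := (wt_measurable a).comp measurable_fst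
    have m2 : Measurable (fun p : ℝ × F => Real.exp (-1 * ‖p.2 - p.1 • x‖ ^ 2)) :=
      Continuous.measurable (by fun_prop)
    have m3 : Measurable (fun p : ℝ × F => sf S p.2) :=
      ((sf_continuous S).comp continuous_snd).measurable
    exact ((m1.mul m2).mul m3).aestronglyMeasurable
  · filter_upwards with p
    rw [Real.norm_eq_abs, abs_mul, abs_mul, abs_of_nonneg (wt_nonneg ha _),
      abs_of_pos (Real.exp_pos _), Real.norm_eq_abs, sq_abs]
    have h1 := wt_le ha p.1
    have h2 := exp_mix_le ha x p.2 hx p.1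
    have h3 : |sf S p.2| ≤ R * (1 + ‖p.2‖ ^ 2) := by
      refine (hR p.2).trans ?_
      gcongr
      have := abs_le_one_add_sq ‖p.2‖
      rwa [abs_norm] at this
    calc wt a p.1 * Real.exp (-1 * ‖p.2 - p.1 • x‖ ^ 2) * |sf S p.2|
        ≤ (a * Real.exp (-a * p.1 ^ 2)) * Real.exp (-1 * ‖p.2 - p.1 • x‖ ^ 2)
          * (R * (1 + ‖p.2‖ ^ 2)) := by gcongr
      _ = a * (Real.exp (-a * p.1 ^ 2) * Real.exp (-1 * ‖p.2 - p.1 • x‖ ^ 2))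
          * (R * (1 + ‖p.2‖ ^ 2)) := by ring
      _ ≤ a * (Real.exp (-(a / 2) * p.1 ^ 2) * Real.exp (-(1 - (1 + a / 2)⁻¹) * ‖p.2‖ ^ 2))
          * (R * (1 + ‖p.2‖ ^ 2)) := by gcongr
      _ = _ := by ring

theorem Tf_eq_swap (S : ConvexBody F) {a : ℝ} (ha : 0 < a) (x : F) (hx : ‖x‖ = 1) :
    Tf S a x = 2 * ∫ y : F, ∫ t : ℝ, wt a t * Real.exp (-1 * ‖y - t • x‖ ^ 2) * sf S y := by
  have hI := mix_integrable S ha x hx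
  have hg : ∀ t : ℝ, Integrable (fun g : F => Real.exp (-1 * ‖g‖ ^ 2) * sf S (t • x + g)) := by
    intro t
    obtain ⟨R, hR0, hR⟩ := exists_sf_bound S
    refine ((gauss_integrable_sq (F := F) one_pos).const_mul (R * (1 + |t|))).mono' ?_ ?_
    · exact (Continuous.mul (by fun_prop)
        ((sf_continuous S).comp (by fun_prop))).aestronglyMeasurable
    · filter_upwards with g
      rw [Real.norm_eq_abs, abs_mul, abs_of_pos (Real.exp_pos _)]
      have h1 := hR (t • x + g)
      have h2 : ‖t • x + g‖ ≤ |t| + ‖g‖ := by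
        refine (norm_add_le _ _).trans ?_
        rw [norm_smul, hx, mul_one, Real.norm_eq_abs]
      have h3 := abs_le_one_add_sq ‖g‖
      rw [abs_norm] at h3
      have h4 : |t| + ‖g‖ ≤ (1 + |t|) * (1 + ‖g‖ ^ 2) := by
        nlinarith [abs_nonneg t, mul_nonneg (abs_nonneg t) (sq_nonneg ‖g‖)]
      have h5 := h1.trans (mul_le_mul_of_nonneg_left (h2.trans h4) hR0)
      refine (mul_le_mul_of_nonneg_left h5 (Real.exp_pos _).le).trans (le_of_eq ?_)
      ring
  unfold Tf
  have hsw := integral_integral_swap (μ := (volume : Measure ℝ)) (ν := (volume : Measure F))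
    (f := fun t y => wt a t * Real.exp (-1 * ‖y - t • x‖ ^ 2) * sf S y) hI
  rw [integral_prod _ (Tf_integrable S ha x), ← hsw, ← integral_const_mul]
  congr 1; ext t
  have e1 : ∀ g : F, wt a t * Real.exp (-1 * ‖g‖ ^ 2) * qf S t g x
      = wt a t * (Real.exp (-1 * ‖g‖ ^ 2) * sf S (t • x + g))
        + wt a t * (Real.exp (-1 * ‖-g‖ ^ 2) * sf S (t • x + -g)) := by
    intro g
    unfold qf
    rw [hx, one_smul, norm_neg, sub_eq_add_neg]; ring
  simp only [e1]
  rw [integral_add ((hg t).const_mul _) ((hg t).comp_neg.const_mul _), integral_const_mul,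
    integral_const_mul, integral_neg_eq_self (fun g : F => Real.exp (-1 * ‖g‖ ^ 2) * sf S (t • x + g))]
  have e2 : ∫ g : F, Real.exp (-1 * ‖g‖ ^ 2) * sf S (t • x + g)
      = ∫ y : F, Real.exp (-1 * ‖y - t • x‖ ^ 2) * sf S y := by
    rw [← integral_add_left_eq_self
      (fun y : F => Real.exp (-1 * ‖y - t • x‖ ^ 2) * sf S y) (t • x)]
    congr 1; ext g
    rw [add_sub_cancel_left]
  rw [e2, ← two_mul]
  congr 1
  rw [← integral_const_mul]
  congr 1; ext y; ring

theorem inner_t_integral {a : ℝ} (ha : 0 < a) (x y : F) (hx : ‖x‖ = 1) :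
    ∫ t : ℝ, wt a t * Real.exp (-1 * ‖y - t • x‖ ^ 2)
      = Real.exp (-1 * ‖y‖ ^ 2) *
        (czero * ∫ u : F, (fk (1 + 2 * a) y u - fk (1 + a) y u) * |inner ℝ u x|) := by
  have hA : 0 < 1 + a := by positivity
  have hB : 0 < 1 + 2 * a := by positivity
  obtain ⟨iA, eA⟩ := fk_cosine hA y x hx
  obtain ⟨iB, eB⟩ := fk_cosine hB y x hx
  set s := inner ℝ x y with hs
  have hIntg : ∀ α : ℝ, 0 < α → Integrable (fun u : F => fk α y u * |inner ℝ u x|) := by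
    intro α hα
    apply fk_integrable hα y (by fun_prop)
    intro u
    rw [abs_abs]
    have h1 := abs_real_inner_le_norm u x
    rw [hx, mul_one] at h1
    have h3 := abs_le_one_add_sq ‖u‖
    rw [abs_norm] at h3
    exact h1.trans h3
  have e1 : czero * ∫ u : F, (fk (1 + 2 * a) y u - fk (1 + a) y u) * |inner ℝ u x|
      = ∫ t : ℝ, wt a t * Real.exp (-t ^ 2) * Real.cosh (2 * (t * s)) := by
    simp_rw [sub_mul]
    rw [integral_sub (hIntg _ hB) (hIntg _ hA), mul_sub, ← eA, ← eB, ← integral_sub iB iA]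
    congr 1; ext t
    have h1 : Real.exp (-(1 + a) * t ^ 2) = Real.exp (-a * t ^ 2) * Real.exp (-t ^ 2) := by
      rw [← Real.exp_add]; congr 1; ring
    have h2 : Real.exp (-(1 + 2 * a) * t ^ 2)
        = Real.exp (-(2 * a) * t ^ 2) * Real.exp (-t ^ 2) := by
      rw [← Real.exp_add]; congr 1; ring
    rw [h1, h2]
    unfold wt
    ring
  have hi : ∀ r : ℝ, Integrable (fun t : ℝ => wt a t * Real.exp (-t ^ 2) * Real.exp (2 * (t * r)))
      := by
    intro r
    have hw : Integrable (fun t : ℝ => wt a t) := by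
      simpa using wt_integrable ha (g := fun _ => 1) (by fun_prop) (fun t => by
        rw [abs_one]; nlinarith [sq_nonneg t])
    refine (hw.mul_const (Real.exp (r ^ 2))).mono' ?_ ?_
    · exact (((wt_measurable a).mul (by fun_prop)).mul (by fun_prop)).aestronglyMeasurable
    · filter_upwards with t
      rw [Real.norm_of_nonneg (mul_nonneg (mul_nonneg (wt_nonneg ha t) (Real.exp_pos _).le)
        (Real.exp_pos _).le), mul_assoc, ← Real.exp_add]
      apply mul_le_mul_of_nonneg_left _ (wt_nonneg ha t)
      apply Real.exp_le_exp.2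
      nlinarith [sq_nonneg (t - r)]
  have hneg : ∫ t : ℝ, wt a t * Real.exp (-t ^ 2) * Real.exp (2 * (t * (-s)))
      = ∫ t : ℝ, wt a t * Real.exp (-t ^ 2) * Real.exp (2 * (t * s)) := by
    rw [← integral_neg_eq_self (fun t : ℝ => wt a t * Real.exp (-t ^ 2) * Real.exp (2 * (t * s)))]
    congr 1; ext t
    have : wt a (-t) = wt a t := by unfold wt; rw [neg_sq]
    rw [this, neg_sq]
    congr 2; ring
  have e2 : ∫ t : ℝ, wt a t * Real.exp (-t ^ 2) * Real.cosh (2 * (t * s))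
      = ∫ t : ℝ, wt a t * Real.exp (-t ^ 2) * Real.exp (2 * (t * s)) := by
    have h1 : ∀ t : ℝ, wt a t * Real.exp (-t ^ 2) * Real.cosh (2 * (t * s))
        = (wt a t * Real.exp (-t ^ 2) * Real.exp (2 * (t * s))
          + wt a t * Real.exp (-t ^ 2) * Real.exp (2 * (t * (-s)))) / 2 := by
      intro t
      rw [Real.cosh_eq]
      have : -(2 * (t * s)) = 2 * (t * (-s)) := by ring
      rw [this]; ring
    simp_rw [h1]
    rw [integral_div, integral_add (hi s) (hi (-s)), hneg]
    ring
  rw [e1, e2, ← integral_const_mul]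
  congr 1; ext t
  have h1 : -1 * ‖y - t • x‖ ^ 2 = -1 * ‖y‖ ^ 2 + (-t ^ 2 + 2 * (t * s)) := by
    rw [norm_sub_sq_real, inner_smul_right, norm_smul, hx, mul_one, Real.norm_eq_abs, sq_abs, hs,
      real_inner_comm]
    ring
  rw [h1, Real.exp_add, Real.exp_add]
  ring

/-- the signed density representing the smoothed body -/
def Ph (S : ConvexBody F) (a : ℝ) (p : F × F) : ℝ :=
  2 * czero * (sf S p.1 * Real.exp (-1 * ‖p.1‖ ^ 2) * (fk (1 + 2 * a) p.1 p.2 - fk (1 + a) p.1 p.2))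

theorem Ph_continuous (S : ConvexBody F) (a : ℝ) : Continuous (Ph S a) := by
  unfold Ph
  exact continuous_const.mul ((((sf_continuous S).comp continuous_fst).mul (by fun_prop)).mul
    ((fk_continuous _).sub (fk_continuous _)))

theorem Ph_integrable (S : ConvexBody F) {a : ℝ} (ha : 0 < a) :
    Integrable (fun p : F × F => Ph S a p * ‖p.2‖) (volume.prod volume) := by
  obtain ⟨R, hR0, hR⟩ := exists_sf_bound S
  have key : ∀ α : ℝ, 1 < α → Integrable (fun p : F × F =>
      sf S p.1 * Real.exp (-1 * ‖p.1‖ ^ 2) * fk α p.1 p.2 * ‖p.2‖) (volume.prod volume) := by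
    intro α hα
    have hα0 : 0 < α := by linarith
    have hc : 0 < 1 - α⁻¹ := by
      have := inv_lt_one_of_one_lt₀ hα
      linarith
    have hb4 : 0 < 1 / (4 * α) := by positivity
    have hG : 0 < ∫ v : F, Real.exp (-(1 / (4 * α)) * ‖v‖ ^ 2) := gauss_pos hb4
    refine (((gauss_integrable_sq (F := F) hc).mul_prod (gauss_integrable_sq (F := F) hb4)).const_mul
      (R / ∫ v : F, Real.exp (-(1 / (4 * α)) * ‖v‖ ^ 2))).mono' ?_ ?_
    · exact (((((sf_continuous S).comp continuous_fst).mul (by fun_prop)).mul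
        (fk_continuous _)).mul (by fun_prop)).aestronglyMeasurable
    · filter_upwards with p
      rw [Real.norm_eq_abs, abs_mul, abs_mul, abs_mul, abs_of_pos (Real.exp_pos _), abs_norm]
      have h1 : |sf S p.1| ≤ R * (1 + ‖p.1‖ ^ 2) := by
        refine (hR p.1).trans ?_
        gcongr
        have := abs_le_one_add_sq ‖p.1‖
        rwa [abs_norm] at this
      have h2 := fk_abs_le hα0 p.1 p.2
      have h3 := abs_le_one_add_sq ‖p.2‖
      rw [abs_norm] at h3
      set G := ∫ v : F, Real.exp (-(1 / (4 * α)) * ‖v‖ ^ 2)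
      have h4 : Real.exp (-(1 - α⁻¹) * ‖p.1‖ ^ 2)
          = Real.exp (-1 * ‖p.1‖ ^ 2) * Real.exp (‖p.1‖ ^ 2 / α) := by
        rw [← Real.exp_add]; congr 1; ring
      rw [h4]
      calc |sf S p.1| * Real.exp (-1 * ‖p.1‖ ^ 2) * |fk α p.1 p.2| * ‖p.2‖
          ≤ (R * (1 + ‖p.1‖ ^ 2)) * Real.exp (-1 * ‖p.1‖ ^ 2)
            * (Real.exp (‖p.1‖ ^ 2 / α) / G * Real.exp (-(1 / (4 * α)) * ‖p.2‖ ^ 2))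
            * (1 + ‖p.2‖ ^ 2) := by gcongr
        _ = _ := by ring
  have := ((key (1 + 2 * a) (by linarith)).sub (key (1 + a) (by linarith))).const_mul (2 * czero)
  refine this.congr ?_
  filter_upwards with p
  simp only [Pi.sub_apply]
  unfold Ph
  ring

theorem Tf_eq_Ph (S : ConvexBody F) {a : ℝ} (ha : 0 < a) (x : F) (hx : ‖x‖ = 1) :
    Tf S a x = ∫ p : F × F, Ph S a p * |inner ℝ p.2 x| ∂(volume.prod volume) := by
  have hi : Integrable (fun p : F × F => Ph S a p * |inner ℝ p.2 x|) (volume.prod volume) := by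
    refine (Ph_integrable S ha).norm.mono'
      ((Ph_continuous S a).mul (by fun_prop)).aestronglyMeasurable ?_
    filter_upwards with p
    rw [Real.norm_eq_abs, abs_mul, abs_abs, Real.norm_eq_abs, abs_mul, abs_norm]
    have h1 := abs_real_inner_le_norm p.2 x
    rw [hx, mul_one] at h1
    gcongr
  rw [Tf_eq_swap S ha x hx, integral_prod _ hi, ← integral_const_mul]
  congr 1; ext y
  rw [integral_mul_const, inner_t_integral ha x y hx]
  have : ∀ u : F, Ph S a (y, u) * |inner ℝ u x|
      = (2 * czero * (sf S y * Real.exp (-1 * ‖y‖ ^ 2)))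
        * ((fk (1 + 2 * a) y u - fk (1 + a) y u) * |inner ℝ u x|) := by
    intro u; unfold Ph; ring
  simp only [this]
  rw [integral_const_mul]
  ring

variable {k : ℕ} {μ : ConvexBody F → ℂ}

theorem KV.symm_approx (hk : k ≠ 0) (h : KV k μ) (hseg : ∀ K u, μ (K + segBody (-u) u) = μ K)
    (S : ConvexBody F) {a : ℝ} (ha : 0 < a) (S' : ConvexBody F) (hS' : ∀ x, sf S' x = Tf S a x) :
    μ S' = 0 := by
  have hm : AEStronglyMeasurable (fun p : F × F => p.2) (volume.prod volume) :=
    continuous_snd.aestronglyMeasurable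
  have hP := Ph_integrable S ha
  have hc := Ph_continuous S a
  have ip : Integrable (fun p : F × F => max (Ph S a p) 0 * ‖p.2‖) (volume.prod volume) := by
    refine hP.norm.mono' ((hc.max continuous_const).mul (by fun_prop)).aestronglyMeasurable ?_
    filter_upwards with p
    rw [norm_mul, norm_mul]
    refine mul_le_mul_of_nonneg_right ?_ (norm_nonneg _)
    rw [Real.norm_of_nonneg (le_max_right _ _), Real.norm_eq_abs]
    exact max_le (le_abs_self _) (abs_nonneg _)
  have im : Integrable (fun p : F × F => max (-Ph S a p) 0 * ‖p.2‖) (volume.prod volume) := by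
    refine hP.norm.mono' ((hc.neg.max continuous_const).mul (by fun_prop)).aestronglyMeasurable ?_
    filter_upwards with p
    rw [norm_mul, norm_mul]
    refine mul_le_mul_of_nonneg_right ?_ (norm_nonneg _)
    rw [Real.norm_of_nonneg (le_max_right _ _), Real.norm_eq_abs]
    exact max_le (neg_le_abs _) (abs_nonneg _)
  obtain ⟨Z2, e2, m2⟩ := exists_zonoid h hseg (volume.prod volume)
    (fun p : F × F => max (Ph S a p) 0) (fun p => p.2) (fun p => le_max_right _ _)
    (hc.max continuous_const).aestronglyMeasurable hm ip
  obtain ⟨Z1, e1, m1⟩ := exists_zonoid h hseg (volume.prod volume)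
    (fun p : F × F => max (-Ph S a p) 0) (fun p => p.2) (fun p => le_max_right _ _)
    (hc.neg.max continuous_const).aestronglyMeasurable hm im
  have key : ∀ (ρ : F × F → ℝ), Continuous ρ → (∀ p, 0 ≤ ρ p) →
      Integrable (fun p : F × F => ρ p * ‖p.2‖) (volume.prod volume) → ∀ x : F, ‖x‖ = 1 →
      Integrable (fun p : F × F => ρ p * |inner ℝ p.2 x|) (volume.prod volume) := by
    intro ρ hρ h0 hi x hx
    refine hi.mono' (hρ.mul (by fun_prop)).aestronglyMeasurable ?_
    filter_upwards with p
    rw [Real.norm_eq_abs, abs_mul, abs_abs, abs_of_nonneg (h0 p)]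
    have h1 := abs_real_inner_le_norm p.2 x
    rw [hx, mul_one] at h1
    exact mul_le_mul_of_nonneg_left h1 (h0 p)
  have heq : S' + Z1 = Z2 := by
    apply eq_of_sf
    intro u
    have := sf_diff_sphere (S' + Z1) Z2 (ε := 0) (fun x hx => by
      rw [sf_add, hS', e1 x hx, e2 x hx, Tf_eq_Ph S ha x hx, abs_le]
      have : ∫ p : F × F, max (Ph S a p) 0 * |inner ℝ p.2 x| ∂(volume.prod volume)
          - ∫ p : F × F, max (-Ph S a p) 0 * |inner ℝ p.2 x| ∂(volume.prod volume)
          = ∫ p : F × F, Ph S a p * |inner ℝ p.2 x| ∂(volume.prod volume) := by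
        rw [← integral_sub (key _ (hc.max continuous_const) (fun p => le_max_right _ _) ip x hx)
          (key (fun p => max (-Ph S a p) 0) (hc.neg.max continuous_const)
            (fun p => le_max_right _ _) im x hx)]
        congr 1; ext p
        rw [← sub_mul]
        congr 1
        rcases le_total 0 (Ph S a p) with h | h
        · rw [max_eq_left h, max_eq_right (by linarith)]; ring
        · rw [max_eq_right h, max_eq_left (by linarith)]; ring
      constructor <;> linarith) u
    rw [zero_mul] at this
    have := abs_nonpos_iff.1 this
    linarith
  rw [← m1, heq, ← zero_add Z2, m2, h.zero_body hk]

theorem KV.symm_vanish (hk : k ≠ 0) (h : KV k μ) (hseg : ∀ K u, μ (K + segBody (-u) u) = μ K)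
    (S : ConvexBody F) (hS : ∀ x ∈ S, -x ∈ S) : μ S = 0 := by
  obtain ⟨R, hR0, -, hR⟩ := exists_sf_lip S
  have hev : ∀ u, sf S (-u) = sf S u := by
    have key : ∀ u, sf S (-u) ≤ sf S u := by
      intro u
      apply sf_le
      intro x hx
      have := le_sf S u (hS x hx)
      rwa [inner_neg_right, ← inner_neg_left] at this
    intro u
    apply le_antisymm (key u)
    have := key (-u)
    rwa [neg_neg] at this
  set c := 2 * (∫ t, wt 1 t * |t|) * (∫ g : F, Real.exp (-1 * ‖g‖ ^ 2)) with hc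
  have hc0 : 0 < c := by
    have h1 := wt_abs_pos
    have h2 := gauss_pos (F := F) one_pos
    positivity
  set C := 2 * R * (∫ t, wt 1 t) * (∫ g : F, Real.exp (-1 * ‖g‖ ^ 2) * ‖g‖) with hC
  have hC0 : 0 ≤ C := by
    have h1 : 0 ≤ ∫ t, wt 1 t := integral_nonneg (fun t => wt_nonneg one_pos t)
    have h2 : 0 ≤ ∫ g : F, Real.exp (-1 * ‖g‖ ^ 2) * ‖g‖ :=
      integral_nonneg (fun g => by positivity)
    positivity
  have hex : ∀ n : ℕ, ∃ S' : ConvexBody F, ∀ x, sf S' x = Tf S ((1 / ((n : ℝ) + 1)) ^ 2) x :=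
    fun n => exists_Tf_body S (by positivity)
  choose S' hS' using hex
  have hz : ∀ n, μ (S' n) = 0 := fun n => h.symm_approx hk hseg S (by positivity) (S' n) (hS' n)
  have lim : Filter.Tendsto S' Filter.atTop (nhds (c • S)) := by
    rw [tendsto_iff_dist_tendsto_zero]
    have hlim : Filter.Tendsto (fun n : ℕ => C * (1 / ((n : ℝ) + 1))) Filter.atTop (nhds 0) := by
      simpa using (tendsto_one_div_add_atTop_nhds_zero_nat (𝕜 := ℝ)).const_mul C
    refine squeeze_zero (fun _ => dist_nonneg) (fun n => ?_) hlim
    apply dist_le_of_sf _ _ (by positivity)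
    intro u
    rw [hS', sf_smul S hc0.le]
    exact Tf_near S hR hev (by positivity) u
  have h1 := tendsto_nhds_unique ((h.cont.tendsto _).comp lim)
    (tendsto_const_nhds.congr (fun n => (hz n).symm))
  rw [h.hom c hc0.le S _ (ConvexBody.coe_smul c S)] at h1
  rcases mul_eq_zero.1 h1 with h2 | h2
  · have := pow_eq_zero_iff hk |>.1 h2
    exact absurd (Complex.ofReal_eq_zero.1 this) hc0.ne'
  · exact h2

end SymmetricBodies

/-! ### Cutting polytopes into simplices -/
section Polytopes

variable {F : Type*} [NormedAddCommGroup F] [InnerProductSpace ℝ F]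

/-- extension of `μ` to all sets by zero -/
def nu (μ : ConvexBody F → ℂ) (A : Set F) : ℂ :=
  @dite ℂ (Convex ℝ A ∧ IsCompact A ∧ A.Nonempty) (Classical.propDecidable _)
    (fun h => μ ⟨A, h.1, h.2.1, h.2.2⟩) (fun _ => 0)

theorem nu_coe (μ : ConvexBody F → ℂ) (K : ConvexBody F) : nu μ (K : Set F) = μ K := by
  unfold nu
  rw [dif_pos ⟨K.convex, K.isCompact, K.nonempty⟩]
  rfl

theorem nu_mk (μ : ConvexBody F → ℂ) (A : Set F) (h1 : Convex ℝ A) (h2 : IsCompact A)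
    (h3 : A.Nonempty) : nu μ A = μ ⟨A, h1, h2, h3⟩ := nu_coe μ ⟨A, h1, h2, h3⟩

theorem nu_empty (μ : ConvexBody F → ℂ) : nu μ (∅ : Set F) = 0 := by
  unfold nu
  rw [dif_neg]
  simp

/-- `μ` vanishes on lower-dimensional bodies -/
def Simple (μ : ConvexBody F → ℂ) : Prop :=
  ∀ K : ConvexBody F, ∀ g : F →ᵃ[ℝ] ℝ, g ≠ 0 → (∀ x ∈ K, g x = 0) → μ K = 0

variable {k : ℕ} {μ : ConvexBody F → ℂ}

theorem nu_simple (hs : Simple μ) (A : Set F) (g : F →ᵃ[ℝ] ℝ) (hg : g ≠ 0)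
    (hA : ∀ x ∈ A, g x = 0) : nu μ A = 0 := by
  unfold nu
  split_ifs with h
  · exact hs _ g hg hA
  · rfl

theorem nu_refl (h : KV k μ) (p : F) (A : Set F) : nu μ ((fun x => p - x) '' A) = nu μ A := by
  have key : ∀ A : Set F, Convex ℝ A ∧ IsCompact A ∧ A.Nonempty →
      Convex ℝ ((fun x => p - x) '' A) ∧ IsCompact ((fun x => p - x) '' A) ∧
        ((fun x => p - x) '' A).Nonempty := by
    rintro A ⟨h1, h2, h3⟩
    refine ⟨?_, h2.image (by fun_prop), h3.image _⟩
    rintro _ ⟨x, hx, rfl⟩ _ ⟨y, hy, rfl⟩ a b ha hb hab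
    refine ⟨a • x + b • y, h1 hx hy ha hb hab, ?_⟩
    have e : p = a • p + b • p := by rw [← add_smul, hab, one_smul]
    simp only [smul_sub]
    nth_rewrite 1 [e]
    abel
  by_cases hA : Convex ℝ A ∧ IsCompact A ∧ A.Nonempty
  · obtain ⟨a1, a2, a3⟩ := hA
    obtain ⟨b1, b2, b3⟩ := key A ⟨a1, a2, a3⟩
    rw [nu_mk μ _ a1 a2 a3, nu_mk μ _ b1 b2 b3]
    let N : ConvexBody F := ⟨-A, a1.neg, a2.neg, a3.neg⟩
    rw [← h.even ⟨A, a1, a2, a3⟩ N rfl]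
    apply h.trans p
    ext x
    change x ∈ (fun x => p - x) '' A ↔ x ∈ p +ᵥ (-A)
    rw [Set.mem_vadd_set_iff_neg_vadd_mem]
    constructor
    · rintro ⟨y, hy, rfl⟩; simpa using hy
    · intro hx
      refine ⟨p - x, ?_, by simp⟩
      simpa [sub_eq_add_neg, add_comm] using hx
  · have hB : ¬ (Convex ℝ ((fun x => p - x) '' A) ∧ IsCompact ((fun x => p - x) '' A) ∧
        ((fun x => p - x) '' A).Nonempty) := by
      intro hB
      apply hA
      have := key _ hB
      rw [image_image] at this
      simpa using this
    unfold nu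
    rw [dif_neg hA, dif_neg hB]

theorem nu_symm (h : KV k μ) (hsym : ∀ S : ConvexBody F, (∀ x ∈ S, -x ∈ S) → μ S = 0)
    (p : F) (A : Set F) (hA : ∀ x ∈ A, p - x ∈ A) : nu μ A = 0 := by
  unfold nu
  split_ifs with hc
  · obtain ⟨a1, a2, a3⟩ := hc
    let S : ConvexBody F := ⟨(-((1 / 2 : ℝ) • p)) +ᵥ A, a1.vadd _, a2.vadd _, a3.vadd_set⟩
    rw [← h.trans (-((1 / 2 : ℝ) • p)) ⟨A, a1, a2, a3⟩ S rfl]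
    apply hsym
    intro x hx
    change x ∈ (-((1 / 2 : ℝ) • p)) +ᵥ A at hx
    change -x ∈ (-((1 / 2 : ℝ) • p)) +ᵥ A
    rw [Set.mem_vadd_set_iff_neg_vadd_mem, neg_neg, vadd_eq_add] at *
    have := hA _ hx
    convert this using 1
    have e : p = (1 / 2 : ℝ) • p + (1 / 2 : ℝ) • p := by
      rw [← add_smul]; norm_num
    nth_rewrite 2 [e]
    abel
  · rfl

variable [FiniteDimensional ℝ F]

theorem aff_cont (g : F →ᵃ[ℝ] ℝ) : Continuous g := AffineMap.continuous_of_finiteDimensional g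

theorem convex_le_aff (g : F →ᵃ[ℝ] ℝ) : Convex ℝ {x | g x ≤ 0} :=
  (convex_Iic (0 : ℝ)).affine_preimage g

theorem convex_ge_aff (g : F →ᵃ[ℝ] ℝ) : Convex ℝ {x | 0 ≤ g x} :=
  (convex_Ici (0 : ℝ)).affine_preimage g

theorem closed_le_aff (g : F →ᵃ[ℝ] ℝ) : IsClosed {x | g x ≤ 0} :=
  isClosed_le (aff_cont g) continuous_const

theorem closed_ge_aff (g : F →ᵃ[ℝ] ℝ) : IsClosed {x | 0 ≤ g x} :=
  isClosed_le continuous_const (aff_cont g)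

theorem nu_cut (h : KV k μ) (hs : Simple μ) {A : Set F} (hA : Convex ℝ A) (hc : IsCompact A)
    (g : F →ᵃ[ℝ] ℝ) (hg : g ≠ 0) :
    nu μ A = nu μ (A ∩ {x | g x ≤ 0}) + nu μ (A ∩ {x | 0 ≤ g x}) := by
  have hu : A = (A ∩ {x | g x ≤ 0}) ∪ (A ∩ {x | 0 ≤ g x}) := by
    ext x
    simp only [mem_union, mem_inter_iff, mem_setOf_eq]
    have := le_total (g x) 0
    tauto
  have c1 : Convex ℝ (A ∩ {x | g x ≤ 0}) := hA.inter (convex_le_aff g)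
  have c2 : Convex ℝ (A ∩ {x | 0 ≤ g x}) := hA.inter (convex_ge_aff g)
  have k1 : IsCompact (A ∩ {x | g x ≤ 0}) := hc.inter_right (closed_le_aff g)
  have k2 : IsCompact (A ∩ {x | 0 ≤ g x}) := hc.inter_right (closed_ge_aff g)
  rcases (A ∩ {x | g x ≤ 0}).eq_empty_or_nonempty with e1 | n1
  · rw [e1, empty_union] at hu
    rw [e1, nu_empty, zero_add, ← hu]
  rcases (A ∩ {x | 0 ≤ g x}).eq_empty_or_nonempty with e2 | n2
  · rw [e2, union_empty] at hu
    rw [e2, nu_empty, add_zero, ← hu]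
  obtain ⟨a, ha⟩ := n1
  obtain ⟨b, hb⟩ := n2
  obtain ⟨s, t, -, -, -, hm⟩ := exists_mem_segment_inter k1.isClosed k2.isClosed
    (by rw [← hu]; exact hA) ha hb
  have := h.val ⟨_, c1, k1, ⟨a, ha⟩⟩ ⟨_, c2, k2, ⟨b, hb⟩⟩ ⟨A, hA, hc, ⟨a, ha.1⟩⟩
    ⟨(A ∩ {x | g x ≤ 0}) ∩ (A ∩ {x | 0 ≤ g x}), c1.inter c2, k1.inter k2, ⟨_, hm⟩⟩ hu rfl
  rw [nu_mk μ _ c1 k1 ⟨a, ha⟩, nu_mk μ _ c2 k2 ⟨b, hb⟩, nu_mk μ _ hA hc ⟨a, ha.1⟩, ← this,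
    hs ⟨(A ∩ {x | g x ≤ 0}) ∩ (A ∩ {x | 0 ≤ g x}), c1.inter c2, k1.inter k2, ⟨_, hm⟩⟩ g hg, add_zero]
  intro x hx
  exact le_antisymm hx.1.2 hx.2.2

/-- affine parametrization by the corner of a cube -/
def phi {n : ℕ} (v : Fin (n + 1) → F) (t : Fin n → ℝ) : F :=
  v 0 + ∑ i, t i • (v i.succ - v 0)

theorem phi_continuous {n : ℕ} (v : Fin (n + 1) → F) : Continuous (phi v) := by
  unfold phi; fun_prop

theorem phi_comb {n : ℕ} (v : Fin (n + 1) → F) (s t : Fin n → ℝ) {a b : ℝ} (hab : a + b = 1) :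
    phi v (a • s + b • t) = a • phi v s + b • phi v t := by
  unfold phi
  simp only [Pi.add_apply, Pi.smul_apply, smul_eq_mul, add_smul, mul_smul, Finset.sum_add_distrib,
    smul_add, Finset.smul_sum]
  have : v 0 = a • v 0 + b • v 0 := by rw [← add_smul, hab, one_smul]
  nth_rewrite 1 [this]
  abel

theorem phi_image_convex {n : ℕ} (v : Fin (n + 1) → F) {A : Set (Fin n → ℝ)} (hA : Convex ℝ A) :
    Convex ℝ (phi v '' A) := by
  rintro _ ⟨s, hs, rfl⟩ _ ⟨t, ht, rfl⟩ a b ha hb hab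
  exact ⟨a • s + b • t, hA hs ht ha hb hab, phi_comb v s t hab⟩

theorem phi_hull {n : ℕ} (v : Fin (n + 1) → F) :
    convexHull ℝ (range v) = phi v '' (Icc 0 1 ∩ {t | ∑ i, t i ≤ 1}) := by
  apply Subset.antisymm
  · apply convexHull_min
    · rintro _ ⟨i, rfl⟩
      refine Fin.cases ?_ (fun i => ?_) i
      · refine ⟨0, ⟨⟨le_rfl, zero_le_one⟩, by simp⟩, by simp [phi]⟩
      · refine ⟨Pi.single i 1, ⟨⟨?_, ?_⟩, by simp⟩, ?_⟩
        · intro j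
          by_cases hj : j = i
          · subst hj; simp
          · simp [hj]
        · intro j
          by_cases hj : j = i
          · subst hj; simp
          · simp [hj]
        · unfold phi
          rw [Finset.sum_eq_single i]
          · simp
          · intro j _ hj; simp [hj]
          · simp
    · apply phi_image_convex
      apply (convex_Icc _ _).inter
      intro s hs t ht a b ha hb hab
      simp only [mem_setOf_eq] at *
      simp only [Pi.add_apply, Pi.smul_apply, smul_eq_mul, Finset.sum_add_distrib,
        ← Finset.mul_sum]
      nlinarith
  · rintro _ ⟨t, ⟨⟨h0, h1⟩, hσ⟩, rfl⟩
    simp only [mem_setOf_eq] at hσ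
    have hc := convex_convexHull ℝ (range v)
    have := hc.sum_mem (t := Finset.univ) (w := Fin.cons (1 - ∑ i, t i) t)
      (z := v) (by
        intro i _
        refine Fin.cases ?_ (fun i => ?_) i
        · simpa using hσ
        · simpa using h0 i) (by rw [Fin.sum_univ_succ]; simp)
      (fun i _ => subset_convexHull ℝ _ (mem_range_self i))
    convert this using 1
    rw [Fin.sum_univ_succ]
    unfold phi
    simp only [Fin.cons_zero, Fin.cons_succ, smul_sub, Finset.sum_sub_distrib, sub_smul, one_smul,
      Finset.sum_smul]
    abel

theorem exists_aff_of_dep {n : ℕ} (hn : Module.finrank ℝ F = n) (v : Fin (n + 1) → F)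
    (hv : ¬ AffineIndependent ℝ v) : ∃ g : F →ᵃ[ℝ] ℝ, g ≠ 0 ∧ ∀ i, g (v i) = 0 := by
  have h1 : Module.finrank ℝ (vectorSpan ℝ (range v)) ≤ n :=
    finrank_vectorSpan_range_le ℝ v (by simp)
  have h2 : Module.finrank ℝ (vectorSpan ℝ (range v)) ≠ n := by
    intro e
    exact hv ((affineIndependent_iff_finrank_vectorSpan_eq ℝ v (by simp)).2 e)
  have h3 : vectorSpan ℝ (range v) ≠ ⊤ := by
    intro e
    rw [e, finrank_top] at h2
    exact h2 hn
  have h4 : (vectorSpan ℝ (range v))ᗮ ≠ ⊥ := by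
    intro e
    exact h3 ((Submodule.orthogonal_eq_bot_iff).1 e)
  obtain ⟨u, hu, hu0⟩ := Submodule.exists_mem_ne_zero_of_ne_bot h4
  let L : F →ₗ[ℝ] ℝ := (innerSL ℝ u).toLinearMap
  refine ⟨L.toAffineMap - AffineMap.const ℝ F (inner ℝ u (v 0)), ?_, ?_⟩
  · intro e
    have e1 := congrArg (fun f : F →ᵃ[ℝ] ℝ => f (v 0 + u)) e
    simp [L, inner_add_right] at e1
    exact hu0 e1
  · intro i
    have : inner ℝ u (v i - v 0) = 0 := by
      apply (Submodule.mem_orthogonal' _ _).1 hu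
      exact vsub_mem_vectorSpan ℝ (mem_range_self i) (mem_range_self 0)
    rw [inner_sub_right] at this
    simpa [L] using this

theorem aff_sum {ι : Type*} [Fintype ι] (g : F →ᵃ[ℝ] ℝ) (w : ι → ℝ) (z : ι → F)
    (hw : ∑ i, w i = 1) : g (∑ i, w i • z i) = ∑ i, w i * g (z i) := by
  have h1 : ∀ x, g x = g.linear x + g 0 := fun x => by
    have := g.map_vadd 0 x
    simpa using this
  rw [h1, map_sum]
  simp only [map_smul, smul_eq_mul]
  simp_rw [fun i => h1 (z i), mul_add, Finset.sum_add_distrib, ← Finset.sum_mul, hw, one_mul]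

/-- existence of an affine function with prescribed values on an affine basis -/
theorem exists_aff_of_indep {n : ℕ} (hn : Module.finrank ℝ F = n) (v : Fin (n + 1) → F)
    (hv : AffineIndependent ℝ v) (c : Fin (n + 1) → ℝ) : ∃ g : F →ᵃ[ℝ] ℝ, ∀ i, g (v i) = c i := by
  let b : AffineBasis (Fin (n + 1)) ℝ F := ⟨v, hv,
    (hv.affineSpan_eq_top_iff_card_eq_finrank_add_one).2 (by simp [hn])⟩
  refine ⟨∑ i, c i • b.coord i, fun j => ?_⟩
  have : v j = b j := rfl
  rw [this]
  have e : ∀ (s : Finset (Fin (n + 1))) (x : F), (∑ i ∈ s, c i • b.coord i) x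
      = ∑ i ∈ s, c i * b.coord i x := by
    intro s x
    induction s using Finset.cons_induction with
    | empty => simp
    | cons a s ha ih => rw [Finset.sum_cons, Finset.sum_cons, AffineMap.coe_add, Pi.add_apply, ih]; simp
  rw [e, Finset.sum_eq_single j]
  · simp
  · intro i _ hij; simp [AffineBasis.coord_apply_ne b hij]
  · simp

theorem nu_simplex (h : KV k μ) (hs : Simple μ)
    (hsym : ∀ S : ConvexBody F, (∀ x ∈ S, -x ∈ S) → μ S = 0)
    {n : ℕ} (hn : Module.finrank ℝ F = n) (hn2 : 2 ≤ n) (v : Fin (n + 1) → F) :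
    nu μ (convexHull ℝ (range v)) = 0 := by
  by_cases hv : AffineIndependent ℝ v
  swap
  · obtain ⟨g, hg, hgv⟩ := exists_aff_of_dep hn v hv
    apply nu_simple hs _ g hg
    have hsub : convexHull ℝ (range v) ⊆ {x | g x ≤ 0} ∩ {x | 0 ≤ g x} := by
      apply convexHull_min _ ((convex_le_aff g).inter (convex_ge_aff g))
      rintro _ ⟨i, rfl⟩
      exact ⟨(hgv i).le, (hgv i).ge⟩
    intro x hx
    exact le_antisymm (hsub hx).1 (hsub hx).2
  obtain ⟨g, hg⟩ := exists_aff_of_indep hn v hv (Fin.cons 0 (fun _ => 1))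
  have hgphi : ∀ t, g (phi v t) = ∑ i, t i := by
    intro t
    have e : phi v t = ∑ i : Fin (n + 1), (Fin.cons (1 - ∑ i, t i) t : Fin (n + 1) → ℝ) i • v i := by
      rw [Fin.sum_univ_succ]
      unfold phi
      simp only [Fin.cons_zero, Fin.cons_succ, smul_sub, Finset.sum_sub_distrib, sub_smul, one_smul,
        Finset.sum_smul]
      abel
    rw [e, aff_sum g _ _ (by rw [Fin.sum_univ_succ]; simp), Fin.sum_univ_succ]
    simp [hg]
  -- affine functionals `g - c`
  let G : ℝ → (F →ᵃ[ℝ] ℝ) := fun c => g - AffineMap.const ℝ F c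
  have hG : ∀ c x, G c x = g x - c := fun c x => rfl
  have hn0 : 0 < n := by omega
  have hG0 : ∀ c, G c ≠ 0 := by
    intro c e
    have e1 : G c (v 0) = 0 := by rw [e]; rfl
    have e2 : G c (v (Fin.succ ⟨0, hn0⟩)) = 0 := by rw [e]; rfl
    rw [hG, hg, Fin.cons_zero] at e1
    rw [hG, hg, Fin.cons_succ] at e2
    linarith
  have hle : ∀ (A : Set (Fin n → ℝ)) c, phi v '' A ∩ {x | G c x ≤ 0}
      = phi v '' (A ∩ {t | ∑ i, t i ≤ c}) := by
    intro A c
    ext x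
    constructor
    · rintro ⟨⟨t, ht, rfl⟩, hx⟩
      simp only [mem_setOf_eq, hG, hgphi] at hx
      exact ⟨t, ⟨ht, by simp only [mem_setOf_eq]; linarith⟩, rfl⟩
    · rintro ⟨t, ⟨ht, hx⟩, rfl⟩
      refine ⟨⟨t, ht, rfl⟩, ?_⟩
      simp only [mem_setOf_eq, hG, hgphi] at *
      linarith
  have hge : ∀ (A : Set (Fin n → ℝ)) c, phi v '' A ∩ {x | 0 ≤ G c x}
      = phi v '' (A ∩ {t | c ≤ ∑ i, t i}) := by
    intro A c
    ext x
    constructor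
    · rintro ⟨⟨t, ht, rfl⟩, hx⟩
      simp only [mem_setOf_eq, hG, hgphi] at hx
      exact ⟨t, ⟨ht, by simp only [mem_setOf_eq]; linarith⟩, rfl⟩
    · rintro ⟨t, ⟨ht, hx⟩, rfl⟩
      refine ⟨⟨t, ht, rfl⟩, ?_⟩
      simp only [mem_setOf_eq, hG, hgphi] at *
      linarith
  have hcub : IsCompact (Icc (0 : Fin n → ℝ) 1) := isCompact_Icc
  -- reflection
  let p : F := phi v 1 + phi v 0
  have hp : ∀ t, p - phi v t = phi v (1 - t) := by
    intro t
    simp only [p, phi, Pi.one_apply, Pi.zero_apply, Pi.sub_apply, sub_smul, Finset.sum_sub_distrib,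
      zero_smul, Finset.sum_const_zero]
    abel
  have hrefl : ∀ t ∈ Icc (0 : Fin n → ℝ) 1, 1 - t ∈ Icc (0 : Fin n → ℝ) 1 := by
    rintro t ⟨h0, h1⟩
    exact ⟨sub_nonneg.2 h1, sub_le_self _ h0⟩
  have hsum : ∀ t : Fin n → ℝ, ∑ i, (1 - t) i = n - ∑ i, t i := by
    intro t; simp
  have cut1 := nu_cut h hs (phi_image_convex v (convex_Icc (0 : Fin n → ℝ) 1))
    (hcub.image (phi_continuous v)) (G 1) (hG0 1)
  rw [hle, hge, ← phi_hull, nu_symm h hsym p (phi v '' Icc 0 1)] at cut1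
  swap
  · rintro _ ⟨t, ht, rfl⟩
    exact ⟨1 - t, hrefl t ht, (hp t).symm⟩
  have hcl : IsClosed {t : Fin n → ℝ | (1 : ℝ) ≤ ∑ i, t i} :=
    isClosed_le continuous_const (by fun_prop)
  have hcv : Convex ℝ {t : Fin n → ℝ | (1 : ℝ) ≤ ∑ i, t i} := by
    intro s hs t ht a b ha hb hab
    simp only [mem_setOf_eq] at *
    simp only [Pi.add_apply, Pi.smul_apply, smul_eq_mul, Finset.sum_add_distrib,
      ← Finset.mul_sum]
    nlinarith
  have cut2 := nu_cut h hs (phi_image_convex v ((convex_Icc (0 : Fin n → ℝ) 1).inter hcv))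
    ((hcub.inter_right hcl).image (phi_continuous v)) (G (n - 1)) (hG0 _)
  rw [hle, hge] at cut2
  have z1 : nu μ (phi v '' (Icc 0 1 ∩ {t | (1 : ℝ) ≤ ∑ i, t i} ∩ {t | ∑ i, t i ≤ (n : ℝ) - 1})) = 0 := by
    apply nu_symm h hsym p
    rintro _ ⟨t, ⟨⟨ht, h1⟩, h2⟩, rfl⟩
    simp only [mem_setOf_eq] at h1 h2
    refine ⟨1 - t, ⟨⟨hrefl t ht, ?_⟩, ?_⟩, (hp t).symm⟩
    · simp only [mem_setOf_eq]; rw [hsum]; linarith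
    · simp only [mem_setOf_eq]; rw [hsum]; linarith
  have z2 : phi v '' (Icc 0 1 ∩ {t | (1 : ℝ) ≤ ∑ i, t i} ∩ {t | (n : ℝ) - 1 ≤ ∑ i, t i})
      = (fun x => p - x) '' (convexHull ℝ (range v)) := by
    rw [phi_hull]
    have hn2' : (2 : ℝ) ≤ n := by exact_mod_cast hn2
    ext x
    constructor
    · rintro ⟨t, ⟨⟨ht, h1⟩, h2⟩, rfl⟩
      simp only [mem_setOf_eq] at h1 h2
      refine ⟨phi v (1 - t), ⟨1 - t, ⟨hrefl t ht, ?_⟩, rfl⟩, ?_⟩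
      · simp only [mem_setOf_eq]; rw [hsum]; linarith
      · simp only; rw [hp]; congr 1; abel
    · rintro ⟨_, ⟨t, ⟨ht, h1⟩, rfl⟩, rfl⟩
      simp only [mem_setOf_eq] at h1
      refine ⟨1 - t, ⟨⟨hrefl t ht, ?_⟩, ?_⟩, (hp t).symm⟩
      · simp only [mem_setOf_eq]; rw [hsum]; linarith
      · simp only [mem_setOf_eq]; rw [hsum]; linarith
  rw [z1, z2, nu_refl h, zero_add] at cut2
  rw [cut2] at cut1
  have : (2 : ℂ) * nu μ (convexHull ℝ (range v)) = 0 := by rw [two_mul]; exact cut1.symm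
  simpa using this

end Polytopes

/-! ### Vanishing on polytopes and approximation -/
section Approx

variable {F : Type*} [NormedAddCommGroup F] [InnerProductSpace ℝ F] [FiniteDimensional ℝ F]
variable {k : ℕ} {μ : ConvexBody F → ℂ}

theorem hull_weights {n : ℕ} (v : Fin (n + 1) → F) {x : F} (hx : x ∈ convexHull ℝ (range v)) :
    ∃ c : Fin (n + 1) → ℝ, (∀ i, 0 ≤ c i) ∧ ∑ i, c i = 1 ∧ x = ∑ i, c i • v i := by
  rw [phi_hull] at hx
  obtain ⟨t, ⟨⟨h0, h1⟩, hσ⟩, rfl⟩ := hx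
  simp only [mem_setOf_eq] at hσ
  refine ⟨Fin.cons (1 - ∑ i, t i) t, ?_, by rw [Fin.sum_univ_succ]; simp, ?_⟩
  · intro i
    refine Fin.cases ?_ (fun i => ?_) i
    · simpa using hσ
    · simpa using h0 i
  · rw [Fin.sum_univ_succ]
    unfold phi
    simp only [Fin.cons_zero, Fin.cons_succ, smul_sub, Finset.sum_sub_distrib, sub_smul, one_smul,
      Finset.sum_smul]
    abel

theorem mem_hull_of_weights {n : ℕ} (v : Fin (n + 1) → F) (c : Fin (n + 1) → ℝ)
    (h0 : ∀ i, 0 ≤ c i) (h1 : ∑ i, c i = 1) : ∑ i, c i • v i ∈ convexHull ℝ (range v) :=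
  (convex_convexHull ℝ (range v)).sum_mem (fun i _ => h0 i) h1
    (fun i _ => subset_convexHull ℝ _ (mem_range_self i))

theorem hull_update {n : ℕ} (v : Fin (n + 1) → F) {i j : Fin (n + 1)} (hij : i ≠ j) {s : ℝ}
    (hs0 : 0 < s) (c : Fin (n + 1) → ℝ)
    (h0 : ∀ i, 0 ≤ c i) (h1 : ∑ i, c i = 1) (hc : (1 - s) * c j ≤ s * c i) :
    ∑ l, c l • v l ∈ convexHull ℝ (range (Function.update v j ((1 - s) • v i + s • v j))) := by
  set w := Function.update v j ((1 - s) • v i + s • v j) with hw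
  let d : Fin (n + 1) → ℝ := Function.update (Function.update c i (c i - c j * (1 - s) / s)) j (c j / s)
  have di : d i = c i - c j * (1 - s) / s := by simp [d, hij]
  have dj : d j = c j / s := by simp [d]
  have dl : ∀ l, l ≠ i ∧ l ≠ j → d l = c l := by
    intro l hl; simp [d, hl.1, hl.2]
  have wj : w j = (1 - s) • v i + s • v j := by simp [w]
  have wl : ∀ l, l ≠ j → w l = v l := by intro l hl; simp [w, hl]
  have hd1 : ∑ l, d l = 1 := by
    rw [← h1, ← sub_eq_zero, ← Finset.sum_sub_distrib,
      Finset.sum_eq_add i j hij (fun l _ hl => by rw [dl l hl, sub_self]) (by simp) (by simp), di, dj]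
    field_simp
    ring
  have hd0 : ∀ l, 0 ≤ d l := by
    intro l
    by_cases hi : l = i
    · rw [hi, di, sub_nonneg, div_le_iff₀ hs0]; linarith
    by_cases hj : l = j
    · rw [hj, dj]; exact div_nonneg (h0 j) hs0.le
    rw [dl l ⟨hi, hj⟩]; exact h0 l
  have e : ∑ l, c l • v l = ∑ l, d l • w l := by
    rw [eq_comm, ← sub_eq_zero, ← Finset.sum_sub_distrib,
      Finset.sum_eq_add i j hij (fun l _ hl => by rw [dl l hl, wl l hl.2, sub_self]) (by simp) (by simp),
      di, dj, wj, wl i hij]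
    have hs' : s ≠ 0 := hs0.ne'
    have : c j / s * s = c j := by field_simp
    rw [smul_add, smul_smul, smul_smul, this, sub_smul]
    have : c j / s * (1 - s) = c j * (1 - s) / s := by ring
    rw [this]
    abel
  rw [e]
  exact mem_hull_of_weights w d hd0 hd1

theorem update_hull_subset {n : ℕ} (v : Fin (n + 1) → F) {i j : Fin (n + 1)} {s : ℝ}
    (hs0 : 0 ≤ s) (hs1 : s ≤ 1) {C : Set F} (hC : Convex ℝ C) (hi : v i ∈ C)
    (hv : ∀ l, l ≠ j → v l ∈ C) (hj : (1 - s) • v i + s • v j ∈ C) :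
    convexHull ℝ (range (Function.update v j ((1 - s) • v i + s • v j))) ⊆
      convexHull ℝ (range v) ∩ C := by
  apply convexHull_min _ ((convex_convexHull ℝ _).inter hC)
  rintro _ ⟨l, rfl⟩
  by_cases hl : l = j
  · subst hl
    rw [Function.update_self]
    refine ⟨?_, hj⟩
    exact convex_convexHull ℝ _ (subset_convexHull ℝ _ (mem_range_self i))
      (subset_convexHull ℝ _ (mem_range_self l)) (by linarith) hs0 (by ring)
  · rw [Function.update_of_ne hl]
    exact ⟨subset_convexHull ℝ _ (mem_range_self l), hv l hl⟩

/-- the intersection with every simplex has zero measure -/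
structure Good (μ : ConvexBody F → ℂ) (n : ℕ) (B : Set F) : Prop where
  closed : IsClosed B
  convex : Convex ℝ B
  zero : ∀ v : Fin (n + 1) → F, nu μ (convexHull ℝ (range v) ∩ B) = 0

theorem compact_hull {n : ℕ} (v : Fin (n + 1) → F) : IsCompact (convexHull ℝ (range v)) :=
  (Set.finite_range v).isCompact_convexHull ℝ

theorem aff_comb (g : F →ᵃ[ℝ] ℝ) (x y : F) (s : ℝ) :
    g ((1 - s) • x + s • y) = (1 - s) * g x + s * g y := by
  have h1 : ∀ x, g x = g.linear x + g 0 := fun x => by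
    have := g.map_vadd 0 x
    simpa using this
  rw [h1, h1 x, h1 y]
  simp only [map_add, map_smul, smul_eq_mul]
  ring

theorem Good.step (h : KV k μ) (hs : Simple μ) {n : ℕ} (hn : Module.finrank ℝ F = n)
    {B : Set F} (hB : Good μ n B) (g : F →ᵃ[ℝ] ℝ) : Good μ n (B ∩ {x | g x ≤ 0}) := by
  classical
  refine ⟨hB.closed.inter (closed_le_aff g), hB.convex.inter (convex_le_aff g), ?_⟩
  have main : ∀ m : ℕ, ∀ v : Fin (n + 1) → F,
      (Finset.univ.filter (fun l => g (v l) ≠ 0)).card = m →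
        nu μ (convexHull ℝ (range v) ∩ (B ∩ {x | g x ≤ 0})) = 0 := by
    intro m
    induction m using Nat.strong_induction_on with
    | _ m ih =>
    intro v hm
    by_cases hneg : ∀ i, g (v i) ≤ 0
    · have : convexHull ℝ (range v) ⊆ {x | g x ≤ 0} := by
        apply convexHull_min _ (convex_le_aff g)
        rintro _ ⟨i, rfl⟩
        exact hneg i
      rw [← hB.zero v]
      congr 1
      ext x
      constructor
      · rintro ⟨a, b, -⟩; exact ⟨a, b⟩
      · rintro ⟨a, b⟩; exact ⟨a, b, this a⟩
    push Not at hneg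
    obtain ⟨j, hj⟩ := hneg
    by_cases hpos : ∀ i, 0 ≤ g (v i)
    · have : convexHull ℝ (range v) ⊆ {x | 0 ≤ g x} := by
        apply convexHull_min _ (convex_ge_aff g)
        rintro _ ⟨i, rfl⟩
        exact hpos i
      apply nu_simple hs _ g
      · rintro rfl
        simp at hj
      · rintro x ⟨a, b, c⟩
        exact le_antisymm c (this a)
    push Not at hpos
    obtain ⟨i, hi⟩ := hpos
    by_cases hv : AffineIndependent ℝ v
    swap
    · obtain ⟨g', hg, hgv⟩ := exists_aff_of_dep hn v hv
      apply nu_simple hs _ g' hg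
      have hsub : convexHull ℝ (range v) ⊆ {x | g' x ≤ 0} ∩ {x | 0 ≤ g' x} := by
        apply convexHull_min _ ((convex_le_aff g').inter (convex_ge_aff g'))
        rintro _ ⟨i, rfl⟩
        exact ⟨(hgv i).le, (hgv i).ge⟩
      intro x hx
      exact le_antisymm (hsub hx.1).1 (hsub hx.1).2
    have hij : i ≠ j := by rintro rfl; linarith
    have hD : 0 < g (v j) - g (v i) := by linarith
    obtain ⟨s, hsdef⟩ : ∃ s, s = - g (v i) / (g (v j) - g (v i)) := ⟨_, rfl⟩
    have hs0 : 0 < s := by rw [hsdef]; apply div_pos _ hD; linarith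
    have hs1 : s < 1 := by rw [hsdef, div_lt_one hD]; linarith
    have hgw : (1 - s) * g (v i) + s * g (v j) = 0 := by
      rw [hsdef]; field_simp; ring
    obtain ⟨g', hg'⟩ := exists_aff_of_indep hn v hv
      (fun l => if l = i then s else if l = j then -(1 - s) else 0)
    have g'i : g' (v i) = s := by rw [hg']; simp
    have g'j : g' (v j) = -(1 - s) := by rw [hg']; simp [hij.symm]
    have g'l : ∀ l, l ≠ i ∧ l ≠ j → g' (v l) = 0 := by intro l hl; rw [hg']; simp [hl.1, hl.2]
    have hg0 : g' ≠ 0 := by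
      rintro rfl
      simp at g'i
      linarith
    have hgx : ∀ c : Fin (n + 1) → ℝ, ∑ l, c l = 1 →
        g' (∑ l, c l • v l) = c i * s - c j * (1 - s) := by
      intro c hc
      rw [aff_sum g' c v hc, Finset.sum_eq_add i j hij
        (fun l _ hl => by rw [g'l l hl, mul_zero]) (by simp) (by simp), g'i, g'j]
      ring
    have count : ∀ (l₀ : Fin (n + 1)) (w : F), g (v l₀) ≠ 0 → g w = 0 →
        nu μ (convexHull ℝ (range (Function.update v l₀ w)) ∩ (B ∩ {x | g x ≤ 0})) = 0 := by
      intro l₀ w h1 h2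
      refine ih _ ?_ (Function.update v l₀ w) rfl
      rw [← hm]
      apply Finset.card_lt_card
      rw [Finset.ssubset_iff_of_subset]
      · refine ⟨l₀, by simp [h1], by simp [h2]⟩
      · intro l hl
        simp only [Finset.mem_filter, Finset.mem_univ, true_and] at *
        by_cases hl0 : l = l₀
        · rw [hl0]; exact h1
        · rwa [Function.update_of_ne hl0] at hl
    have cut := nu_cut h hs (A := convexHull ℝ (range v) ∩ (B ∩ {x | g x ≤ 0}))
      ((convex_convexHull ℝ _).inter (hB.convex.inter (convex_le_aff g)))
      ((compact_hull v).inter_right (hB.closed.inter (closed_le_aff g))) g' hg0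
    have e1 : convexHull ℝ (range v) ∩ {x | 0 ≤ g' x}
        = convexHull ℝ (range (Function.update v j ((1 - s) • v i + s • v j))) := by
      apply Subset.antisymm
      · rintro x ⟨hx, hx'⟩
        obtain ⟨c, c0, c1, rfl⟩ := hull_weights v hx
        rw [mem_setOf_eq, hgx c c1] at hx'
        exact hull_update v hij hs0 c c0 c1 (by linarith)
      · apply update_hull_subset v hs0.le hs1.le (convex_ge_aff g')
        · rw [mem_setOf_eq, g'i]; exact hs0.le
        · intro l hl
          rw [mem_setOf_eq]
          by_cases hli : l = i
          · rw [hli, g'i]; exact hs0.le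
          · rw [g'l l ⟨hli, hl⟩]
        · rw [mem_setOf_eq, aff_comb, g'i, g'j]
          exact le_of_eq (by ring)
    have e2 : convexHull ℝ (range v) ∩ {x | g' x ≤ 0}
        = convexHull ℝ (range (Function.update v i ((1 - (1 - s)) • v j + (1 - s) • v i))) := by
      apply Subset.antisymm
      · rintro x ⟨hx, hx'⟩
        obtain ⟨c, c0, c1, rfl⟩ := hull_weights v hx
        rw [mem_setOf_eq, hgx c c1] at hx'
        exact hull_update v hij.symm (by linarith) c c0 c1 (by linarith)
      · apply update_hull_subset v (by linarith) (by linarith) (convex_le_aff g')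
        · rw [mem_setOf_eq, g'j]; linarith
        · intro l hl
          rw [mem_setOf_eq]
          by_cases hlj : l = j
          · rw [hlj, g'j]; linarith
          · rw [g'l l ⟨hl, hlj⟩]
        · rw [mem_setOf_eq, aff_comb, g'i, g'j]
          exact le_of_eq (by ring)
    rw [cut, inter_right_comm, inter_right_comm (convexHull ℝ (range v)) _ {x | 0 ≤ g' x}, e1, e2,
      count j _ hj.ne' (by rw [aff_comb, hgw]),
      count i _ hi.ne (by rw [aff_comb]; linarith), add_zero]
  intro v
  exact main _ v rfl

/-- the affine function `⟪u, ·⟫ - c` -/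
def affU (u : F) (c : ℝ) : F →ᵃ[ℝ] ℝ :=
  (innerSL ℝ u).toLinearMap.toAffineMap - AffineMap.const ℝ F c

theorem affU_apply (u : F) (c : ℝ) (x : F) : affU u c x = inner ℝ u x - c := rfl

theorem good_finset (h : KV k μ) (hs : Simple μ)
    (hsym : ∀ S : ConvexBody F, (∀ x ∈ S, -x ∈ S) → μ S = 0)
    {n : ℕ} (hn : Module.finrank ℝ F = n) (hn2 : 2 ≤ n) (K : ConvexBody F) (T : Finset F) :
    Good μ n {x | ∀ u ∈ T, inner ℝ u x ≤ sf K u} := by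
  induction T using Finset.cons_induction with
  | empty =>
    refine ⟨by simp, by simpa using convex_univ, fun v => ?_⟩
    simpa using nu_simplex h hs hsym hn hn2 v
  | cons a T ha ih =>
    have := ih.step h hs hn (affU a (sf K a))
    convert this using 1
    ext x
    simp only [Finset.mem_cons, mem_setOf_eq, mem_inter_iff, affU_apply, sub_nonpos,
      forall_eq_or_imp]
    tauto

theorem exists_big_simplex {n : ℕ} (hn : Module.finrank ℝ F = n) (K : ConvexBody F) :
    ∃ v : Fin (n + 1) → F, (K : Set F) ⊆ convexHull ℝ (range v) := by
  obtain ⟨b⟩ := AffineBasis.exists_affineBasis_of_finiteDimensional (ι := Fin (n + 1)) (k := ℝ)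
    (P := F) (by simp [hn])
  have hc := b.centroid_mem_interior_convexHull
  set c := Finset.univ.centroid ℝ b
  obtain ⟨r, hr, hball⟩ := Metric.isOpen_iff.1 isOpen_interior c hc
  obtain ⟨R, hR, hK⟩ := K.isBounded.exists_pos_norm_le
  obtain ⟨δ, hδ⟩ : ∃ δ, δ = r / (2 * R) := ⟨_, rfl⟩
  have hδ0 : 0 < δ := by rw [hδ]; positivity
  refine ⟨fun i => δ⁻¹ • (b i - c), fun x hx => ?_⟩
  have h1 : c + δ • x ∈ convexHull ℝ (range b) := by
    apply interior_subset
    apply hball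
    rw [mem_ball, dist_eq_norm, add_sub_cancel_left, norm_smul, Real.norm_of_nonneg hδ0.le]
    calc δ * ‖x‖ ≤ δ * R := by gcongr; exact hK x hx
      _ = r / 2 := by rw [hδ]; field_simp
      _ < r := by linarith
  obtain ⟨w, w0, w1, e⟩ := hull_weights b h1
  have : x = ∑ i, w i • (δ⁻¹ • (b i - c)) := by
    simp_rw [smul_comm _ δ⁻¹]
    rw [← Finset.smul_sum]
    simp_rw [smul_sub]
    rw [Finset.sum_sub_distrib, ← e, ← Finset.sum_smul, w1, one_smul, add_sub_cancel_left, smul_smul,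
      inv_mul_cancel₀ hδ0.ne', one_smul]
  rw [this]
  exact mem_hull_of_weights _ w w0 w1

theorem KV.vanish_of_simple (h : KV k μ) (hs : Simple μ)
    (hsym : ∀ S : ConvexBody F, (∀ x ∈ S, -x ∈ S) → μ S = 0)
    {n : ℕ} (hn : Module.finrank ℝ F = n) (hn2 : 2 ≤ n) (K : ConvexBody F) : μ K = 0 := by
  by_contra hK
  obtain ⟨ε, hε, hball⟩ := Metric.isOpen_iff.1 (isOpen_ne_fun h.cont (continuous_const (y := (0 : ℂ)))) K hK
  obtain ⟨v, hv⟩ := exists_big_simplex hn K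
  let C : Set F := convexHull ℝ (range v) ∩ {x | ε / 2 ≤ infDist x (K : Set F)}
  have hC : IsCompact C := (compact_hull v).inter_right
    (isClosed_le continuous_const (continuous_infDist_pt _))
  obtain ⟨T, hT⟩ := hC.elim_finite_subcover (fun u : F => {x | sf K u < inner ℝ u x})
    (fun u => isOpen_lt continuous_const (by fun_prop)) (by
      rintro x ⟨-, hx⟩
      have hxK : x ∉ K := by
        intro hxK
        have : infDist x (K : Set F) = 0 := infDist_zero_of_mem hxK
        rw [mem_setOf_eq, this] at hx
        linarith
      rw [mem_iff_sf] at hxK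
      push Not at hxK
      obtain ⟨u, hu⟩ := hxK
      exact mem_iUnion.2 ⟨u, hu⟩)
  have hG := good_finset h hs hsym hn hn2 K T
  set B := {x | ∀ u ∈ T, inner ℝ u x ≤ sf K u} with hBdef
  have hKL : (K : Set F) ⊆ convexHull ℝ (range v) ∩ B :=
    fun x hx => ⟨hv hx, fun u _ => le_sf K u hx⟩
  let L : ConvexBody F := ⟨convexHull ℝ (range v) ∩ B, (convex_convexHull ℝ _).inter hG.convex,
    (compact_hull v).inter_right hG.closed, K.nonempty.mono hKL⟩
  have hL0 : μ L = 0 := by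
    rw [← nu_coe μ L]
    exact hG.zero v
  have hd : dist L K ≤ ε / 2 := by
    rw [← ConvexBody.hausdorffDist_coe]
    apply hausdorffDist_le_of_infDist (by linarith)
    · rintro x ⟨hx, hxB⟩
      by_contra hlt
      push Not at hlt
      have := hT ⟨hx, hlt.le⟩
      simp only [mem_iUnion, mem_setOf_eq] at this
      obtain ⟨u, hu, hlt'⟩ := this
      exact absurd (hxB u hu) (not_le.2 hlt')
    · intro x hx
      have : infDist x (L : Set F) = 0 := infDist_zero_of_mem (hKL hx)
      rw [this]; linarith
  exact hball (mem_ball.2 (by linarith : dist L K < ε)) hL0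

end Approx

/-! ### The main induction -/
section Main

universe u

/-- a body in a subspace, seen as a body in the ambient space -/
def pushBody {V : Type*} [NormedAddCommGroup V] [InnerProductSpace ℝ V]
    (E : Submodule ℝ V) (K : ConvexBody E) : ConvexBody V :=
  ⟨(fun x : E => (x : V)) '' (K : Set E), K.convex.linear_image E.subtype,
    K.isCompact.image continuous_subtype_val, K.nonempty.image _⟩

theorem KV.restrict {V : Type*} [NormedAddCommGroup V] [InnerProductSpace ℝ V] {k : ℕ}
    {μ : ConvexBody V → ℂ} (h : KV k μ) (E : Submodule ℝ V) :
    KV k (fun K : ConvexBody E => μ (pushBody E K)) where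
  val := by
    intro K L M N hM hN
    apply h.val
    · change _ '' (M : Set E) = _ '' (K : Set E) ∪ _ '' (L : Set E)
      rw [hM, image_union]
    · change _ '' (N : Set E) = _ '' (K : Set E) ∩ _ '' (L : Set E)
      rw [hN, image_inter Subtype.val_injective]
  cont := by
    apply h.cont.comp
    apply Isometry.continuous
    apply Isometry.of_dist_eq
    intro K L
    rw [← ConvexBody.hausdorffDist_coe, ← ConvexBody.hausdorffDist_coe]
    exact Metric.hausdorffDist_image (isometry_subtype_coe)
  trans := by
    intro x K L hL
    apply h.trans (x : V)
    change _ '' (L : Set E) = (x : V) +ᵥ (_ '' (K : Set E))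
    rw [hL, ← Set.image_vadd, ← Set.image_vadd, image_image, image_image]
    rfl
  even := by
    intro K L hL
    apply h.even
    change _ '' (L : Set E) = -(_ '' (K : Set E))
    rw [hL, ← Set.image_neg_eq_neg, ← Set.image_neg_eq_neg, image_image, image_image]
    rfl
  hom := by
    intro t ht K L hL
    apply h.hom t ht
    change _ '' (L : Set E) = t • (_ '' (K : Set E))
    rw [hL, ← Set.image_smul, ← Set.image_smul, image_image, image_image]
    rfl

/-- extending a subspace to prescribed dimension -/
theorem exists_extend {V : Type*} [NormedAddCommGroup V] [InnerProductSpace ℝ V]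
    [FiniteDimensional ℝ V] (E : Submodule ℝ V) {m : ℕ} (h1 : Module.finrank ℝ E ≤ m)
    (h2 : m ≤ Module.finrank ℝ V) : ∃ E' : Submodule ℝ V, E ≤ E' ∧ Module.finrank ℝ E' = m := by
  induction m, h1 using Nat.le_induction with
  | base => exact ⟨E, le_rfl, rfl⟩
  | succ m hm ih =>
    obtain ⟨E', hE, hd⟩ := ih (by omega)
    have hne : E' ≠ ⊤ := by
      rintro rfl
      rw [finrank_top] at hd
      omega
    obtain ⟨x, -, hx⟩ := SetLike.exists_of_lt (lt_top_iff_ne_top.2 hne)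
    refine ⟨E' ⊔ Submodule.span ℝ {x}, hE.trans le_sup_left, ?_⟩
    have hx0 : x ≠ 0 := by rintro rfl; exact hx E'.zero_mem
    have hdis : Disjoint E' (Submodule.span ℝ {x}) := by
      rw [Submodule.disjoint_span_singleton' hx0]
      exact hx
    have := Submodule.finrank_sup_add_finrank_inf_eq E' (Submodule.span ℝ {x})
    rw [hdis.eq_bot, finrank_bot, finrank_span_singleton hx0, hd] at this
    omega

theorem klain_aux : ∀ n k : ℕ, k ≤ n → ∀ (V : Type u) [NormedAddCommGroup V]
    [InnerProductSpace ℝ V] [FiniteDimensional ℝ V], Module.finrank ℝ V = n →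
    ∀ μ : ConvexBody V → ℂ, KV k μ →
    (∀ E : Submodule ℝ V, Module.finrank ℝ E = k →
      ∀ K : ConvexBody V, (K : Set V) ⊆ (E : Set V) → μ K = 0) →
    ∀ K : ConvexBody V, μ K = 0 := by
  intro n
  induction n with
  | zero =>
    intro k hk V _ _ _ hV μ h hvan K
    refine hvan ⊤ ?_ K (fun x _ => trivial)
    rw [finrank_top]; omega
  | succ n ihn =>
    intro k
    induction k with
    | zero =>
      intro hk V _ _ _ hV μ h hvan K
      let P : ConvexBody V := ⟨{0}, convex_singleton 0, isCompact_singleton, singleton_nonempty 0⟩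
      have h1 := h.hom 0 le_rfl K P (by
        change {0} = (0 : ℝ) • (K : Set V)
        rw [Set.zero_smul_set K.nonempty]; rfl)
      have h2 := hvan ⊥ (by simp) P (by
        intro x hx
        have hx' : x = 0 := hx
        rw [hx']
        exact Submodule.zero_mem _)
      rw [h2] at h1
      simpa using h1.symm
    | succ k ihk =>
      intro hk V _ _ _ hV μ h hvan
      by_cases hkn : k + 1 = n + 1
      · intro K
        refine hvan ⊤ ?_ K (fun x _ => trivial)
        rw [finrank_top]; omega
      have hseg0 : ∀ (K : ConvexBody V) (u : V), μ (K + segBody 0 u) = μ K := by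
        intro K u
        have := ihk (by omega) V hV _ (h.diff_seg u) (by
          intro E hE K hKE
          obtain ⟨E', hE', hd⟩ := exists_extend (E ⊔ Submodule.span ℝ {u}) (m := k + 1) (by
            have h1 := Submodule.finrank_add_le_finrank_add_finrank E (Submodule.span ℝ {u})
            have h2 := finrank_span_le_card (R := ℝ) ({u} : Set V)
            simp only [toFinset_singleton, Finset.card_singleton] at h2
            have h1' : Module.finrank ℝ ↥(E ⊔ Submodule.span ℝ {u}) ≤ _ := h1
            omega) (by omega)
          have hu : u ∈ E' := hE' (Submodule.mem_sup_right (Submodule.mem_span_singleton_self u))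
          have hEE : E ≤ E' := le_sup_left.trans hE'
          rw [hvan E' hd K (fun x hx => hEE (hKE hx)), hvan E' hd (K + segBody 0 u), sub_zero]
          intro x hx
          have hx' : x ∈ (K : Set V) + (segBody 0 u : Set V) := hx
          obtain ⟨a, ha, b, hb, rfl⟩ := Set.mem_add.1 hx'
          apply E'.add_mem (hEE (hKE ha))
          exact E'.convex.segment_subset E'.zero_mem hu hb) K
        exact sub_eq_zero.1 this
      have hseg : ∀ (K : ConvexBody V) (u : V), μ (K + segBody (-u) u) = μ K := by
        intro K u
        rw [← hseg0 K ((2 : ℝ) • u)]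
        apply h.trans (-u)
        let P : ConvexBody V := ⟨{-u}, convex_singleton _, isCompact_singleton, singleton_nonempty _⟩
        have e : K + segBody (-u) u = P + (K + segBody 0 ((2 : ℝ) • u)) := by
          apply eq_of_sf
          intro w
          have hP : sf P w = inner ℝ w (-u) := by
            obtain ⟨y, hy, e⟩ := exists_sf P w
            have : y = -u := hy
            rw [← e, this]
          rw [sf_add, sf_add, sf_add, sf_segBody, sf_segBody, hP]
          simp only [inner_neg_right, inner_zero_right, inner_smul_right]
          have : max (-inner ℝ w u) (inner ℝ w u) = -inner ℝ w u + max 0 (2 * inner ℝ w u) := by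
            rw [← max_add_add_left]
            congr 1 <;> ring
          rw [this]; ring
        rw [e]
        rw [ConvexBody.coe_add]
        change {-u} + ((K + segBody 0 ((2 : ℝ) • u) : ConvexBody V) : Set V) = _
        rw [Set.singleton_add]
        rfl
      have hsym : ∀ S : ConvexBody V, (∀ x ∈ S, -x ∈ S) → μ S = 0 := by
        borelize V
        exact fun S hS => h.symm_vanish (Nat.succ_ne_zero k) hseg S hS
      have hsimple : Simple μ := by
        intro K g hg hK
        obtain ⟨x₀, hx₀⟩ := K.nonempty
        have hgl : ∀ x, g x = g.linear (x - x₀) := by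
          intro x
          have := g.map_vadd x₀ (x - x₀)
          simpa [hK x₀ hx₀] using this
        have hl0 : g.linear ≠ 0 := by
          intro e
          apply hg
          ext x
          rw [hgl, e]; simp
        let E := LinearMap.ker g.linear
        have hE : Module.finrank ℝ E = n := by
          have h1 := LinearMap.finrank_range_add_finrank_ker g.linear
          have h2 : Module.finrank ℝ (LinearMap.range g.linear) = 1 := by
            rw [LinearMap.range_eq_top.2 (LinearMap.surjective hl0), finrank_top]
            simp
          rw [h2, hV] at h1
          change Module.finrank ℝ (LinearMap.ker g.linear) = n
          omega
        have hr := ihn (k + 1) (by omega) E hE _ (h.restrict E) (by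
          intro D hD L hL
          apply hvan (D.map E.subtype)
          · rw [← hD]
            exact Submodule.finrank_map_subtype_eq E D
          · rintro _ ⟨y, hy, rfl⟩
            exact ⟨y, hL hy, rfl⟩)
        let L : ConvexBody E := ⟨(fun y : E => x₀ + (y : V)) ⁻¹' (K : Set V), by
            intro x hx y hy a b ha hb hab
            have := K.convex hx hy ha hb hab
            change x₀ + (a • (x : V) + b • (y : V)) ∈ (K : Set V)
            convert this using 1
            change x₀ + (a • (x : V) + b • (y : V)) = a • (x₀ + (x : V)) + b • (x₀ + (y : V))
            rw [smul_add, smul_add]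
            have e : x₀ = a • x₀ + b • x₀ := by rw [← add_smul, hab, one_smul]
            nth_rewrite 1 [e]
            abel, by
            apply Topology.IsClosedEmbedding.isCompact_preimage _ K.isCompact
            exact (Homeomorph.addLeft x₀).isClosedEmbedding.comp
              E.closed_of_finiteDimensional.isClosedEmbedding_subtypeVal, ⟨0, by simpa using hx₀⟩⟩
        rw [← hr L, eq_comm]
        apply h.trans (-x₀)
        ext x
        rw [Set.mem_vadd_set_iff_neg_vadd_mem, neg_neg, vadd_eq_add]
        constructor
        · rintro ⟨y, hy, rfl⟩
          exact hy
        · intro hx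
          refine ⟨⟨x, ?_⟩, hx, rfl⟩
          have := hK _ hx
          rw [hgl] at this
          change g.linear x = 0
          simpa using this
      intro K
      exact h.vanish_of_simple hsimple hsym hV (by omega) K

end Main

/-- injectivity of the Klain embedding: an even valuation of degree `k`
vanishing on all convex bodies contained in `k`-dimensional subspaces is zero. -/
theorem statement11 {V : Type*} [NormedAddCommGroup V] [InnerProductSpace ℝ V]
    [FiniteDimensional ℝ V]
    (n k : ℕ) (hV : Module.finrank ℝ V = n) (hk : k ≤ n)
    (μ : ConvexBody V → ℂ) (hval : IsValuationC μ) (hcont : Continuous μ)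
    (htrans : IsTranslationInvariantC μ) (heven : IsEvenValC μ)
    (hhom : IsHomogeneousValC k μ)
    (hvanish : ∀ E : Submodule ℝ V, Module.finrank ℝ E = k →
      ∀ K : ConvexBody V, (K : Set V) ⊆ (E : Set V) → μ K = 0) :
    ∀ K : ConvexBody V, μ K = 0 := by
  exact klain_aux n k hk V hV μ ⟨hval, hcont, htrans, heven, hhom⟩ hvanish

end
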